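/- arXiv:0911.2576 — 9 statements merged into one kernel-verified Lean document; each statement's English description precedes it below -/
import Mathlib

section
/- Let n ≥ 1, R > 0, and define u : ℝⁿ → ℝ by u(x) = (3^{4/3}/4)·(R^{4/3} − |x|^{4/3}). Then u is C² on the punctured ball {x : 0 < |x| < R}, and for every x with 0 < |x| < R it satisfies the ∞-Laplace equation −⟨D²u(x)∇u(x), ∇u(x)⟩ = 1. Moreover u(x) = 0 whenever |x| = R, and for every boundary point x₀ with |x₀| = R the directional derivative of u at x₀ in the outward radial direction x₀/|x₀| equals −(3R)^{1/3}; in particular this equals −a for a > 0 if and only if R = a³/3. -/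
open Set Filter RealInnerProductSpace

lemma aux_pow {n : ℕ} (q : ℝ) (x : EuclideanSpace ℝ (Fin n)) (hx : 0 < ‖x‖) :
    HasFDerivAt (fun y : EuclideanSpace ℝ (Fin n) => (‖y‖ ^ 2) ^ q)
      ((q * (‖x‖ ^ 2) ^ (q - 1)) • ((2 : ℝ) • innerSL ℝ x)) x := by
  have h := (hasStrictFDerivAt_norm_sq x).hasFDerivAt
  have hs : (‖x‖ ^ 2) ≠ 0 := by positivity
  have h2 := (Real.hasDerivAt_rpow_const (p := q) (Or.inl hs)).comp_hasFDerivAt x h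
  refine HasFDerivAt.congr_fderiv h2 ?_
  ext v
  simp

lemma aux_norm {n : ℕ} (y : EuclideanSpace ℝ (Fin n)) :
    ‖y‖ ^ ((4 : ℝ) / 3) = (‖y‖ ^ 2) ^ ((2 : ℝ) / 3) := by
  rw [← Real.rpow_natCast, ← Real.rpow_mul (norm_nonneg y)]
  norm_num

lemma aux_three : (3 : ℝ) ^ ((4 : ℝ) / 3) = 3 * (3 : ℝ) ^ ((1 : ℝ) / 3) := by
  rw [show (4 : ℝ) / 3 = 1 + 1 / 3 by norm_num, Real.rpow_add (by norm_num), Real.rpow_one]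

lemma aux_cube (s : ℝ) (hs : 0 ≤ s) : (s ^ ((1 : ℝ) / 3)) ^ 3 = s := by
  rw [← Real.rpow_natCast, ← Real.rpow_mul hs]
  norm_num

lemma aux_grad {n : ℕ} (R : ℝ) (u : EuclideanSpace ℝ (Fin n) → ℝ)
    (hu : ∀ x, u x = (3 : ℝ) ^ ((4 : ℝ) / 3) / 4 * (R ^ ((4 : ℝ) / 3) - ‖x‖ ^ ((4 : ℝ) / 3)))
    (x : EuclideanSpace ℝ (Fin n)) (hx : 0 < ‖x‖) :
    HasGradientAt u ((-(3 : ℝ) ^ ((1 : ℝ) / 3) * (‖x‖ ^ 2) ^ (-(1 : ℝ) / 3)) • x) x := by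
  have hu' : u = fun x => (3 : ℝ) ^ ((4 : ℝ) / 3) / 4 *
      (R ^ ((4 : ℝ) / 3) - (‖x‖ ^ 2) ^ ((2 : ℝ) / 3)) := by
    funext y; rw [hu, aux_norm]
  rw [hu', hasGradientAt_iff_hasFDerivAt]
  have h := ((aux_pow (2 / 3) x hx).const_sub (R ^ ((4 : ℝ) / 3))).const_mul
    ((3 : ℝ) ^ ((4 : ℝ) / 3) / 4)
  refine HasFDerivAt.congr_fderiv h ?_
  refine ContinuousLinearMap.ext fun v => ?_
  rw [aux_three, show (2 : ℝ) / 3 - 1 = -1 / 3 by norm_num]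
  simp only [InnerProductSpace.toDual_apply_apply, inner_smul_left, ContinuousLinearMap.smul_apply,
    ContinuousLinearMap.neg_apply, innerSL_apply_apply, smul_eq_mul]
  simp
  ring

/-- the radial function `u(x) = (3^{4/3}/4)(R^{4/3} - |x|^{4/3})` is `C²` on the
punctured ball, solves `-⟨D²u ∇u, ∇u⟩ = 1` there, vanishes on `|x| = R`, has outward normal
derivative `-(3R)^{1/3}` on the boundary, and this equals `-a` iff `R = a³/3`. -/
theorem stmt_0 (n : ℕ) (hn : 1 ≤ n) (R : ℝ) (hR : 0 < R)
    (u : EuclideanSpace ℝ (Fin n) → ℝ)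
    (hu : ∀ x, u x = (3 : ℝ) ^ ((4 : ℝ) / 3) / 4 * (R ^ ((4 : ℝ) / 3) - ‖x‖ ^ ((4 : ℝ) / 3))) :
    ContDiffOn ℝ 2 u {x | 0 < ‖x‖ ∧ ‖x‖ < R} ∧
    (∀ x : EuclideanSpace ℝ (Fin n), 0 < ‖x‖ → ‖x‖ < R →
      -⟪fderiv ℝ (gradient u) x (gradient u x), gradient u x⟫ = 1) ∧
    (∀ x : EuclideanSpace ℝ (Fin n), ‖x‖ = R → u x = 0) ∧
    (∀ x₀ : EuclideanSpace ℝ (Fin n), ‖x₀‖ = R →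
      lineDeriv ℝ u x₀ (‖x₀‖⁻¹ • x₀) = -((3 * R) ^ ((1 : ℝ) / 3))) ∧
    (∀ a : ℝ, 0 < a → (-((3 * R) ^ ((1 : ℝ) / 3)) = -a ↔ R = a ^ 3 / 3)) := by
  have hpos : ∀ x : EuclideanSpace ℝ (Fin n), 0 < ‖x‖ → (‖x‖ ^ 2) ≠ 0 := by
    intro x hx; positivity
  refine ⟨?_, ?_, ?_, ?_, ?_⟩
  · have hu' : u = fun x => (3 : ℝ) ^ ((4 : ℝ) / 3) / 4 *
        (R ^ ((4 : ℝ) / 3) - (‖x‖ ^ 2) ^ ((2 : ℝ) / 3)) := by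
      funext y; rw [hu, aux_norm]
    rw [hu']
    intro x hx
    apply ContDiffAt.contDiffWithinAt
    exact contDiffAt_const.mul (contDiffAt_const.sub
      ((contDiff_norm_sq ℝ).contDiffAt.rpow_const_of_ne (hpos x hx.1)))
  · intro x hx _
    have hg := (aux_grad R u hu x hx).gradient
    have hev : gradient u =ᶠ[nhds x] fun y =>
        (-(3 : ℝ) ^ ((1 : ℝ) / 3) * (‖y‖ ^ 2) ^ (-(1 : ℝ) / 3)) • y := by
      filter_upwards [(isOpen_lt continuous_const continuous_norm).mem_nhds hx] with y hy
      exact (aux_grad R u hu y hy).gradient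
    have hd := ((aux_pow (-(1 : ℝ) / 3) x hx).const_mul (-(3 : ℝ) ^ ((1 : ℝ) / 3))).smul
      (hasFDerivAt_id x)
    have hd' : fderiv ℝ (gradient u) x = _ := hev.fderiv_eq.trans hd.fderiv
    rw [hd', hg]
    have hs : 0 < ‖x‖ ^ 2 := by positivity
    have ht := aux_cube (‖x‖ ^ 2) hs.le
    have ht0 : 0 < (‖x‖ ^ 2) ^ ((1 : ℝ) / 3) := by positivity
    have hk := aux_cube 3 (by norm_num)
    have e1 : (‖x‖ ^ 2) ^ (-(1 : ℝ) / 3) = ((‖x‖ ^ 2) ^ ((1 : ℝ) / 3))⁻¹ := by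
      rw [← Real.rpow_neg hs.le]; norm_num
    have e2 : (‖x‖ ^ 2) ^ (-(1 : ℝ) / 3 - 1) =
        ((‖x‖ ^ 2) ^ ((1 : ℝ) / 3))⁻¹ * (‖x‖ ^ 2)⁻¹ := by
      rw [Real.rpow_sub hs, e1, Real.rpow_one]; rfl
    rw [e1, e2]
    generalize (‖x‖ ^ 2) ^ ((1 : ℝ) / 3) = t at *
    generalize (3 : ℝ) ^ ((1 : ℝ) / 3) = k at *
    simp only [ContinuousLinearMap.add_apply, ContinuousLinearMap.smul_apply,
      ContinuousLinearMap.smulRight_apply, ContinuousLinearMap.id_apply, innerSL_apply_apply,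
      inner_add_left, inner_smul_left, inner_smul_right, real_inner_self_eq_norm_sq, smul_eq_mul,
      conj_trivial, id]
    rw [← ht]
    field_simp
    linear_combination hk
  · intro x hx
    rw [hu, hx]; ring
  · intro x hx
    have hx0 : 0 < ‖x‖ := hx ▸ hR
    have h := (aux_grad R u hu x hx0).hasFDerivAt
    rw [(h.hasLineDerivAt _).lineDeriv]
    simp only [InnerProductSpace.toDual_apply_apply, inner_smul_left, inner_smul_right,
      real_inner_self_eq_norm_sq, conj_trivial]
    rw [hx, Real.mul_rpow (by norm_num) hR.le]
    have e : (R ^ 2) ^ (-(1 : ℝ) / 3) = R ^ ((1 : ℝ) / 3) * R⁻¹ := by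
      rw [← Real.rpow_natCast, ← Real.rpow_mul hR.le, ← Real.rpow_neg_one R, ← Real.rpow_add hR]
      norm_num
    rw [e]
    field_simp
  · intro a ha
    have hk := aux_cube (3 * R) (by positivity)
    rw [neg_inj]
    constructor
    · intro h
      rw [h] at hk
      linarith
    · intro h
      have : 3 * R = a ^ 3 := by linarith
      rw [this] at hk ⊢
      exact (pow_left_inj₀ (by positivity) ha.le (by norm_num)).1 hk
end

section
/- Let n ≥ 1, c ∈ ℝ, k = 3^{4/3}/4, and u(x) = c − k|x|^{4/3} on ℝⁿ. If φ is a C² function on a neighborhood of 0 with φ(0) = u(0) and φ(x) ≥ u(x) for all x near 0 (φ touches u from above at 0), then ∇φ(0) = 0; consequently −⟨D²φ(0)∇φ(0), ∇φ(0)⟩ − 1 = −1 ≤ 0, so the viscosity subsolution condition for −⟨D²u∇u,∇u⟩ = 1 holds at the origin. -/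
open Set Filter RealInnerProductSpace

/-- for `u(x) = c - (3^{4/3}/4)|x|^{4/3}`, any `C²` function touching `u` from
above at the origin has vanishing gradient there, hence the viscosity subsolution condition for
`-⟨D²u ∇u, ∇u⟩ = 1` holds at the origin. -/
theorem stmt_1 (n : ℕ) (hn : 1 ≤ n) (c : ℝ) (k : ℝ) (hk : k = (3 : ℝ) ^ ((4 : ℝ) / 3) / 4)
    (u : EuclideanSpace ℝ (Fin n) → ℝ)
    (hu : ∀ x, u x = c - k * ‖x‖ ^ ((4 : ℝ) / 3))
    (φ : EuclideanSpace ℝ (Fin n) → ℝ) (hφ : ContDiffAt ℝ 2 φ 0)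
    (htouch : φ 0 = u 0) (habove : ∀ᶠ x in nhds 0, u x ≤ φ x) :
    gradient φ 0 = 0 ∧
    -⟪fderiv ℝ (gradient φ) 0 (gradient φ 0), gradient φ 0⟫ - 1 = -1 ∧
    -⟪fderiv ℝ (gradient φ) 0 (gradient φ 0), gradient φ 0⟫ - 1 ≤ 0 := by
  have h1 : HasFDerivAt (fun x : EuclideanSpace ℝ (Fin n) => ‖x‖ ^ ((4 : ℝ) / 3))
      (0 : EuclideanSpace ℝ (Fin n) →L[ℝ] ℝ) 0 := by
    have h := hasFDerivAt_norm_rpow (0 : EuclideanSpace ℝ (Fin n))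
      (p := (4 : ℝ) / 3) (by norm_num)
    simpa using h
  have h2 : HasFDerivAt φ (fderiv ℝ φ 0) 0 :=
    (hφ.differentiableAt (by norm_num)).hasFDerivAt
  have h3 := h2.add (h1.const_mul k)
  have hmin : IsLocalMin (φ + fun x : EuclideanSpace ℝ (Fin n) => k * ‖x‖ ^ ((4 : ℝ) / 3)) 0 := by
    filter_upwards [habove] with x hx
    have h0 := hu 0
    rw [hu x] at hx
    simp only [Pi.add_apply]
    linarith
  have h4 := hmin.hasFDerivAt_eq_zero h3
  have h5 : fderiv ℝ φ 0 = 0 := by simpa using h4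
  have h6 : gradient φ 0 = 0 := by simp [gradient, h5]
  refine ⟨h6, ?_, ?_⟩ <;> simp [h6]
end

section
/- Let n ≥ 1, c ∈ ℝ, k = 3^{4/3}/4, and u(x) = c − k|x|^{4/3} on ℝⁿ. Then there is no C² function ψ on a neighborhood of 0 with ψ(0) = u(0) and ψ(x) ≤ u(x) for all x near 0 (no C² test function touches u from below at the origin); consequently the viscosity supersolution condition for −⟨D²u∇u,∇u⟩ = 1 holds vacuously at 0. -/
open Set Filter RealInnerProductSpace

/-- for `u(x) = c - (3^{4/3}/4)|x|^{4/3}`, no `C²` test function touches `u` from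
below at the origin, so the viscosity supersolution condition for `-⟨D²u ∇u, ∇u⟩ = 1` holds
vacuously at the origin. -/
theorem stmt_2 (n : ℕ) (hn : 1 ≤ n) (c : ℝ) (k : ℝ) (hk : k = (3 : ℝ) ^ ((4 : ℝ) / 3) / 4)
    (u : EuclideanSpace ℝ (Fin n) → ℝ)
    (hu : ∀ x, u x = c - k * ‖x‖ ^ ((4 : ℝ) / 3)) :
    ¬ ∃ ψ : EuclideanSpace ℝ (Fin n) → ℝ,
        ContDiffAt ℝ 2 ψ 0 ∧ ψ 0 = u 0 ∧ ∀ᶠ x in nhds 0, ψ x ≤ u x := by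
  rintro ⟨ψ, hψ, h0, hle⟩
  have hkpos : 0 < k := by rw [hk]; positivity
  have hu0 : u 0 = c := by rw [hu]; simp
  have hmax : IsLocalMax ψ 0 := by
    filter_upwards [hle] with x hx
    rw [h0, hu0]
    have h1 : 0 ≤ k * ‖x‖ ^ ((4 : ℝ) / 3) := by positivity
    rw [hu] at hx
    linarith
  have hf0 : fderiv ℝ ψ 0 = 0 := hmax.fderiv_eq_zero
  have hd : ContDiffAt ℝ 1 (fderiv ℝ ψ) 0 := hψ.fderiv_right (by norm_num)
  obtain ⟨K, hK⟩ := (hd.differentiableAt (by norm_num)).isBigO_sub.bound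
  have hdiff : ∀ᶠ x in nhds (0 : EuclideanSpace ℝ (Fin n)), DifferentiableAt ℝ ψ x := by
    filter_upwards [hψ.eventually (by simp)] with x hx
    exact hx.differentiableAt (by norm_num)
  obtain ⟨r, hr, hball⟩ := Metric.eventually_nhds_iff_ball.1 ((hK.and hdiff).and hle)
  have key : ∀ x ∈ Metric.ball (0 : EuclideanSpace ℝ (Fin n)) r,
      k * ‖x‖ ^ ((4 : ℝ) / 3) ≤ |K| * ‖x‖ * ‖x‖ := by
    intro x hx
    have hxr : ‖x‖ < r := by simpa using hx
    have hsub : ∀ y ∈ Metric.closedBall (0 : EuclideanSpace ℝ (Fin n)) ‖x‖,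
        y ∈ Metric.ball (0 : EuclideanSpace ℝ (Fin n)) r := by
      intro y hy
      have : ‖y‖ ≤ ‖x‖ := by simpa using hy
      simpa using lt_of_le_of_lt this hxr
    have hmv := (convex_closedBall (0 : EuclideanSpace ℝ (Fin n)) ‖x‖).norm_image_sub_le_of_norm_fderiv_le
      (𝕜 := ℝ) (f := ψ) (C := |K| * ‖x‖) (x := 0) (y := x)
      (fun y hy => (hball y (hsub y hy)).1.2)
      (fun y hy => by
        have h1 := (hball y (hsub y hy)).1.1
        rw [hf0, sub_zero, sub_zero] at h1
        have h2 : ‖y‖ ≤ ‖x‖ := by simpa using hy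
        calc _ ≤ K * ‖y‖ := h1
          _ ≤ |K| * ‖y‖ := by gcongr; exact le_abs_self K
          _ ≤ _ := by gcongr)
      (by simp) (by simp)
    rw [sub_zero, Real.norm_eq_abs, h0, hu0] at hmv
    have h3 := (hball x hx).2
    rw [hu] at h3
    have h4 := (abs_le.1 hmv).1
    linarith
  have key2 : ∀ᶠ s in nhdsWithin (0 : ℝ) (Ioi 0), k ≤ |K| * s ^ 2 := by
    have hs : ∀ᶠ s in nhdsWithin (0 : ℝ) (Ioi 0), s ^ 3 < r := by
      have : Tendsto (fun s : ℝ => s ^ 3) (nhds 0) (nhds 0) := by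
        have h : Continuous (fun s : ℝ => s ^ 3) := by fun_prop
        simpa using h.tendsto 0
      exact (this.eventually (gt_mem_nhds hr)).filter_mono nhdsWithin_le_nhds
    filter_upwards [hs, self_mem_nhdsWithin] with s hsr hs0
    have hs0 : 0 < s := hs0
    let x : EuclideanSpace ℝ (Fin n) := EuclideanSpace.single ⟨0, hn⟩ (s ^ 3)
    have hx : ‖x‖ = s ^ 3 := by
      simp [x, abs_of_pos hs0]
    have h := key x (by simpa [hx] using hsr)
    have hp : (s ^ 3) ^ ((4 : ℝ) / 3) = s ^ 4 := by
      rw [← Real.rpow_natCast, ← Real.rpow_mul hs0.le, ← Real.rpow_natCast]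
      norm_num
    rw [hx, hp] at h
    have h4 : 0 < s ^ 4 := by positivity
    refine le_of_mul_le_mul_right ?_ h4
    calc _ ≤ _ := h
      _ = _ := by ring
  have hlim : Tendsto (fun s : ℝ => |K| * s ^ 2) (nhdsWithin 0 (Ioi 0)) (nhds 0) := by
    have h : Continuous (fun s : ℝ => |K| * s ^ 2) := by fun_prop
    have := h.tendsto 0
    simp only [ne_eq, OfNat.ofNat_ne_zero, not_false_eq_true, zero_pow, mul_zero] at this
    exact this.mono_left nhdsWithin_le_nhds
  have := ge_of_tendsto hlim key2
  linarith
end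

section
/- Let Ω ⊆ ℝⁿ be open, a > 0, u ∈ C²(Ω) satisfy ⟨D²u(y)∇u(y), ∇u(y)⟩ = −1 for all y ∈ Ω, and let x : [0,T] → Ω with T ≤ a²/2 be differentiable with x′(t) = ∇u(x(t)) for all t and |∇u(x(0))| = a. Then for every t ∈ [0,T], |x(t) − x(0)| ≤ (1/3)(a³ − (a² − 2t)^{3/2}) ≤ a³/3. In particular the trajectory never reaches a distance greater than a³/3 from its starting point. -/
open Set Filter RealInnerProductSpace

/-- along a line of steepest ascent starting with `|∇u(x(0))| = a`, the trajectory
satisfies `|x(t) - x(0)| ≤ (1/3)(a³ - (a² - 2t)^{3/2}) ≤ a³/3`; in particular it never reaches a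
distance greater than `a³/3` from its starting point. -/
theorem stmt_4 (n : ℕ) (Ω : Set (EuclideanSpace ℝ (Fin n))) (hΩ : IsOpen Ω) (a : ℝ) (ha : 0 < a)
    (u : EuclideanSpace ℝ (Fin n) → ℝ) (hu : ContDiffOn ℝ 2 u Ω)
    (heq : ∀ y ∈ Ω, ⟪fderiv ℝ (gradient u) y (gradient u y), gradient u y⟫ = -1)
    (T : ℝ) (hT0 : 0 ≤ T) (hT : T ≤ a ^ 2 / 2) (x : ℝ → EuclideanSpace ℝ (Fin n))
    (hmem : ∀ t ∈ Set.Icc (0 : ℝ) T, x t ∈ Ω)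
    (hode : ∀ t ∈ Set.Icc (0 : ℝ) T, HasDerivAt x (gradient u (x t)) t)
    (hinit : ‖gradient u (x 0)‖ = a) :
    ∀ t ∈ Set.Icc (0 : ℝ) T,
      ‖x t - x 0‖ ≤ 1 / 3 * (a ^ 3 - (a ^ 2 - 2 * t) ^ ((3 : ℝ) / 2)) ∧
      1 / 3 * (a ^ 3 - (a ^ 2 - 2 * t) ^ ((3 : ℝ) / 2)) ≤ a ^ 3 / 3 := by
  have hgd : ∀ y ∈ Ω, DifferentiableAt ℝ (gradient u) y := by
    intro y hy
    have h1 : ContDiffAt ℝ 2 u y := hu.contDiffAt (hΩ.mem_nhds hy)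
    have h2 : ContDiffAt ℝ 1 (fderiv ℝ u) y := h1.fderiv_right (by norm_num)
    have h3 : DifferentiableAt ℝ (fderiv ℝ u) y := h2.differentiableAt (by norm_num)
    exact (InnerProductSpace.toDual ℝ (EuclideanSpace ℝ (Fin n))).symm.toContinuousLinearEquiv.differentiableAt.comp y h3
  have hder : ∀ t ∈ Set.Icc (0 : ℝ) T,
      HasDerivAt (fun s => ‖gradient u (x s)‖ ^ 2 + 2 * s) 0 t := by
    intro t ht
    have h1 : HasDerivAt (fun s => gradient u (x s))
        (fderiv ℝ (gradient u) (x t) (gradient u (x t))) t :=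
      (hgd _ (hmem t ht)).hasFDerivAt.comp_hasDerivAt t (hode t ht)
    have h2 := h1.norm_sq.add ((hasDerivAt_id t).const_mul 2)
    refine h2.congr_deriv ?_
    rw [real_inner_comm, heq _ (hmem t ht)]
    norm_num
  have hsq : ∀ t ∈ Set.Icc (0 : ℝ) T, ‖gradient u (x t)‖ ^ 2 = a ^ 2 - 2 * t := by
    intro t ht
    have h := constant_of_has_deriv_right_zero
      (f := fun s => ‖gradient u (x s)‖ ^ 2 + 2 * s) (a := 0) (b := T)
      (fun s hs => (hder s hs).continuousAt.continuousWithinAt)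
      (fun s hs => (hder s ⟨hs.1, hs.2.le⟩).hasDerivWithinAt) t ht
    simp only [hinit] at h
    linarith
  have hB : ∀ t : ℝ, HasDerivAt
      (fun s : ℝ => 1 / 3 * (a ^ 3 - (a ^ 2 - 2 * s) ^ ((3 : ℝ) / 2)))
      ((a ^ 2 - 2 * t) ^ ((1 : ℝ) / 2)) t := by
    intro t
    have h0 : HasDerivAt (fun s : ℝ => a ^ 2 - 2 * s) (-2) t := by
      simpa using ((hasDerivAt_id t).const_mul (2 : ℝ)).const_sub (a ^ 2)
    have h1 := ((h0.rpow_const (p := (3 : ℝ) / 2) (Or.inr (by norm_num))).const_sub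
      (a ^ 3)).const_mul (1 / 3 : ℝ)
    refine h1.congr_deriv ?_
    rw [show (3 : ℝ) / 2 - 1 = 1 / 2 by norm_num]
    ring
  intro t ht
  constructor
  · refine image_norm_le_of_norm_deriv_right_le_deriv_boundary
      (f := fun s => x s - x 0) (f' := fun s => gradient u (x s)) (a := 0) (b := T)
      (B := fun s : ℝ => 1 / 3 * (a ^ 3 - (a ^ 2 - 2 * s) ^ ((3 : ℝ) / 2)))
      (B' := fun s => (a ^ 2 - 2 * s) ^ ((1 : ℝ) / 2))
      (fun s hs => ((hode s hs).sub_const _).continuousAt.continuousWithinAt)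
      (fun s hs => ((hode s ⟨hs.1, hs.2.le⟩).sub_const _).hasDerivWithinAt) ?_ hB ?_ ht
    · have h3 : (a ^ 2 : ℝ) ^ ((3 : ℝ) / 2) = a ^ 3 := by
        rw [← Real.rpow_natCast a 2, ← Real.rpow_mul ha.le, ← Real.rpow_natCast a 3]
        norm_num
      simp [h3]
    · intro s hs
      rw [← hsq s ⟨hs.1, hs.2.le⟩, ← Real.sqrt_eq_rpow, Real.sqrt_sq (norm_nonneg _)]
  · have h4 : 0 ≤ (a ^ 2 - 2 * t) ^ ((3 : ℝ) / 2) :=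
      Real.rpow_nonneg (by linarith [ht.2]) _
    linarith
end

section
/- Let U ⊆ ℝⁿ be open, w ∈ C²(U) with |∇w(x)| = 1 for all x ∈ U, f : ℝ → ℝ a C² function, and u = f ∘ w. Then for every x ∈ U, ⟨D²u(x)∇u(x), ∇u(x)⟩ = f′(w(x))²·f″(w(x)). In particular, if a > 0, 0 < w(x) < a³/3 on U and f(d) = (1/4)[a⁴ − (a³ − 3d)^{4/3}], then −⟨D²u∇u, ∇u⟩ = 1 classically on U. -/
open Set Filter RealInnerProductSpace

theorem web_aux (n : ℕ) (U : Set (EuclideanSpace ℝ (Fin n))) (hU : IsOpen U)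
    (w : EuclideanSpace ℝ (Fin n) → ℝ) (hw : ContDiffOn ℝ 2 w U)
    (heik : ∀ x ∈ U, ‖gradient w x‖ = 1) (f g : ℝ → ℝ) (g' : ℝ)
    (hf : ∀ x ∈ U, HasDerivAt f (g (w x)) (w x))
    (x : EuclideanSpace ℝ (Fin n)) (hx : x ∈ U) (hg : HasDerivAt g g' (w x)) :
    ⟪fderiv ℝ (gradient (f ∘ w)) x (gradient (f ∘ w) x), gradient (f ∘ w) x⟫ =
        (g (w x)) ^ 2 * g' := by
  have hwc : ∀ y ∈ U, ContDiffAt ℝ 2 w y := fun y hy => hw.contDiffAt (hU.mem_nhds hy)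
  have hwd : ∀ y ∈ U, DifferentiableAt ℝ w y := fun y hy =>
    (hwc y hy).differentiableAt (by norm_num)
  have hgrad : ∀ y ∈ U, gradient (f ∘ w) y = g (w y) • gradient w y := by
    intro y hy
    have h := (hf y hy).comp_hasFDerivAt y (hwd y hy).hasFDerivAt
    simp [gradient, h.fderiv]
  have hG : DifferentiableAt ℝ (gradient w) x := by
    have h1 : DifferentiableAt ℝ (fderiv ℝ w) x :=
      ((hwc x hx).fderiv_right (m := 1) (by norm_num)).differentiableAt (by norm_num)
    exact ((InnerProductSpace.toDual ℝ
      (EuclideanSpace ℝ (Fin n))).symm.toContinuousLinearEquiv.differentiableAt).comp x h1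
  have horth : ∀ v, ⟪fderiv ℝ (gradient w) x v, gradient w x⟫ = 0 := by
    intro v
    have h1 := hG.hasFDerivAt.inner ℝ hG.hasFDerivAt
    have h2 : (fun y => ⟪gradient w y, gradient w y⟫) =ᶠ[nhds x] fun _ => (1 : ℝ) := by
      filter_upwards [hU.mem_nhds hx] with y hy
      rw [real_inner_self_eq_norm_sq, heik y hy]; norm_num
    have h3 := h1.unique ((hasFDerivAt_const (1 : ℝ) x).congr_of_eventuallyEq h2)
    have h4 := congrArg (fun L => L v) h3
    simp at h4
    simpa using h4
  have hev : gradient (f ∘ w) =ᶠ[nhds x] fun y => g (w y) • gradient w y := by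
    filter_upwards [hU.mem_nhds hx] with y hy using hgrad y hy
  have hgw := hg.comp_hasFDerivAt x (hwd x hx).hasFDerivAt
  have hD := (hgw.smul hG.hasFDerivAt).congr_of_eventuallyEq hev
  have hself : ⟪gradient w x, gradient w x⟫ = (1 : ℝ) := by
    rw [real_inner_self_eq_norm_sq, heik x hx]; norm_num
  have hfd : fderiv ℝ w x (gradient w x) = 1 := by
    rw [← hself, inner_gradient_left]
  rw [hD.fderiv, hgrad x hx]
  simp only [map_smul, inner_smul_left, inner_smul_right, add_apply,
    smul_apply, ContinuousLinearMap.smulRight_apply, inner_add_left,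
    horth, hself, hfd, Function.comp, smul_eq_mul]
  simp
  ring

/-- for a web-function `u = f ∘ w` built from a `C²` solution `w` of the eikonal
equation `|∇w| = 1` and `C²` profile `f`, one has `⟨D²u ∇u, ∇u⟩ = f'(w)² f''(w)`; in particular
with `f(d) = (1/4)[a⁴ - (a³ - 3d)^{4/3}]` and `0 < w < a³/3` on `U`, `-⟨D²u ∇u, ∇u⟩ = 1`
classically on `U`. -/
theorem stmt_7 (n : ℕ) (U : Set (EuclideanSpace ℝ (Fin n))) (hU : IsOpen U)
    (w : EuclideanSpace ℝ (Fin n) → ℝ) (hw : ContDiffOn ℝ 2 w U)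
    (heik : ∀ x ∈ U, ‖gradient w x‖ = 1) :
    (∀ f : ℝ → ℝ, ContDiff ℝ 2 f → ∀ x ∈ U,
      ⟪fderiv ℝ (gradient (f ∘ w)) x (gradient (f ∘ w) x), gradient (f ∘ w) x⟫ =
        (deriv f (w x)) ^ 2 * deriv (deriv f) (w x)) ∧
    (∀ a : ℝ, 0 < a → (∀ x ∈ U, w x ∈ Set.Ioo 0 (a ^ 3 / 3)) →
      ∀ x ∈ U,
        -⟪fderiv ℝ
            (gradient ((fun d => 1 / 4 * (a ^ 4 - (a ^ 3 - 3 * d) ^ ((4 : ℝ) / 3))) ∘ w)) x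
            (gradient ((fun d => 1 / 4 * (a ^ 4 - (a ^ 3 - 3 * d) ^ ((4 : ℝ) / 3))) ∘ w) x),
          gradient ((fun d => 1 / 4 * (a ^ 4 - (a ^ 3 - 3 * d) ^ ((4 : ℝ) / 3))) ∘ w) x⟫ = 1) := by
  refine ⟨fun f hf x hx => ?_, fun a ha hr x hx => ?_⟩
  · have h1 : ContDiff ℝ 1 (deriv f) := by
      have : ContDiff ℝ (1 + 1) f := by simpa [one_add_one_eq_two] using hf
      exact (contDiff_succ_iff_deriv.1 this).2.2
    exact web_aux n U hU w hw heik f (deriv f) _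
      (fun y _ => ((hf.differentiable (by norm_num)) _).hasDerivAt) x hx
      ((h1.differentiable (by norm_num)) _).hasDerivAt
  · have hpos : ∀ y ∈ U, 0 < a ^ 3 - 3 * w y := fun y hy => by
      have := (hr y hy).2
      linarith
    have hlin : ∀ d : ℝ, HasDerivAt (fun d => a ^ 3 - 3 * d) (-3) d := fun d => by
      simpa using ((hasDerivAt_id d).const_mul 3).const_sub (a ^ 3)
    have hp := hpos x hx
    rw [web_aux n U hU w hw heik _ (fun d => (a ^ 3 - 3 * d) ^ ((1 : ℝ) / 3))
      (-(a ^ 3 - 3 * w x) ^ (-(2 : ℝ) / 3)) ?_ x hx ?_]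
    · have : ((a ^ 3 - 3 * w x) ^ ((1 : ℝ) / 3)) ^ 2 * (a ^ 3 - 3 * w x) ^ (-(2 : ℝ) / 3) = 1 := by
        rw [← Real.rpow_natCast, ← Real.rpow_mul hp.le, ← Real.rpow_add hp]
        norm_num
      linarith
    · intro y hy
      have h := (((hlin (w y)).rpow_const (p := (4 : ℝ) / 3)
        (Or.inl (hpos y hy).ne')).const_sub (a ^ 4)).const_mul (1 / 4)
      refine h.congr_deriv ?_
      rw [show (4 : ℝ) / 3 - 1 = 1 / 3 by norm_num]
      ring
    · have h := (hlin (w x)).rpow_const (p := (1 : ℝ) / 3) (Or.inl hp.ne')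
      refine h.congr_deriv ?_
      rw [show (1 : ℝ) / 3 - 1 = -2 / 3 by norm_num]
      ring
end

section
/- (Sufficiency part of Theorem 2.1.) Let Ω ⊂ ℝⁿ be a bounded open connected set, a > 0, d(x) = dist(x, ∂Ω), and let R ⊂ Ω be a set closed in Ω such that: d is C² on the open set Ω \ R with |∇d| = 1 there; d(x) = a³/3 for every x ∈ R; and d(x) < a³/3 for every x ∈ Ω \ R. Define u(x) = (1/4)[a⁴ − (a³ − 3d(x))^{4/3}] for x ∈ Ω. Then u is a viscosity solution of −⟨D²u Du, Du⟩ = 1 in Ω: it satisfies the equation classically on Ω \ R, and at every point z ∈ R every C² test function touching u from above has vanishing gradient at z (so the subsolution condition holds there) while no C² test function touches u from below at z (so the supersolution condition holds vacuously). Moreover u extends continuously by 0 to ∂Ω. -/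
open Set Filter RealInnerProductSpace Topology

/-- Gradient of a `C²` function is differentiable. -/
lemma differentiableAt_gradient_of_C2 {E : Type*} [NormedAddCommGroup E] [InnerProductSpace ℝ E]
    [CompleteSpace E] {f : E → ℝ} {x : E} (hf : ContDiffAt ℝ 2 f x) :
    DifferentiableAt ℝ (gradient f) x := by
  have h1 : DifferentiableAt ℝ (fderiv ℝ f) x :=
    (hf.fderiv_right (m := 1) (by norm_num)).differentiableAt (by norm_num)
  have h2 : gradient f = fun y => (InnerProductSpace.toDual ℝ E).symm (fderiv ℝ f y) := rfl
  rw [h2]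
  exact ((InnerProductSpace.toDual ℝ E).symm.differentiableAt).comp x h1

lemma classical_part {E : Type*} [NormedAddCommGroup E] [InnerProductSpace ℝ E]
    [CompleteSpace E] {d u : E → ℝ} {a : ℝ} {U : Set E} (hU : IsOpen U)
    (hC : ContDiffOn ℝ 2 d U) (heik : ∀ x ∈ U, ‖gradient d x‖ = 1)
    (hlt : ∀ x ∈ U, d x < a ^ 3 / 3)
    (hu : ∀ x, u x = 1 / 4 * (a ^ 4 - (a ^ 3 - 3 * d x) ^ ((4 : ℝ) / 3)))
    (x : E) (hx : x ∈ U) :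
    -⟪fderiv ℝ (gradient u) x (gradient u x), gradient u x⟫ = 1 := by
  have hCat : ∀ y ∈ U, ContDiffAt ℝ 2 d y := fun y hy => hC.contDiffAt (hU.mem_nhds hy)
  have hdg : ∀ y ∈ U, HasGradientAt d (gradient d y) y := fun y hy =>
    ((hCat y hy).differentiableAt (by norm_num)).hasGradientAt
  have hug : ∀ y ∈ U, gradient u y = ((a ^ 3 - 3 * d y) ^ ((1 : ℝ) / 3)) • gradient d y := by
    intro y hy
    have hw : 0 < a ^ 3 - 3 * d y := by have := hlt y hy; linarith
    have h0 : HasFDerivAt d _ y := (hdg y hy).hasFDerivAt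
    have h1 := ((((h0.const_mul 3).const_sub (a ^ 3)).rpow_const
      (p := (4 : ℝ) / 3) (Or.inl hw.ne')).const_sub (a ^ 4)).const_mul (1 / 4)
    have h2 : HasGradientAt u (((a ^ 3 - 3 * d y) ^ ((1 : ℝ) / 3)) • gradient d y) y := by
      rw [hasGradientAt_iff_hasFDerivAt]
      have hu' : u = fun x => 1 / 4 * (a ^ 4 - (a ^ 3 - 3 * d x) ^ ((4 : ℝ) / 3)) := funext hu
      rw [hu']
      refine h1.congr_fderiv ?_
      have : (4 : ℝ) / 3 - 1 = 1 / 3 := by norm_num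
      rw [this, map_smulₛₗ, conj_trivial]
      module
    exact h2.gradient
  have hG := (differentiableAt_gradient_of_C2 (hCat x hx)).hasFDerivAt
  set G' := fderiv ℝ (gradient d) x with hG'
  have hw : 0 < a ^ 3 - 3 * d x := by have := hlt x hx; linarith
  have horth : ∀ v, ⟪G' v, gradient d x⟫ = 0 := by
    intro v
    have h1 := hG.norm_sq
    have h2 : (fun y => ‖gradient d y‖ ^ 2) =ᶠ[𝓝 x] fun _ => (1 : ℝ) := by
      filter_upwards [hU.mem_nhds hx] with y hy
      rw [heik y hy]; norm_num
    have h3 := (h1.congr_of_eventuallyEq h2.symm).unique (hasFDerivAt_const (1 : ℝ) x)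
    have h4 := congrArg (fun L => L v) h3
    rw [real_inner_comm]
    simpa [inner_gradient_left] using h4
  have h0 : HasFDerivAt d _ x := (hdg x hx).hasFDerivAt
  have hp := ((h0.const_mul 3).const_sub (a ^ 3)).rpow_const
      (p := (1 : ℝ) / 3) (Or.inl hw.ne')
  have hm := hp.smul hG
  have hev : gradient u =ᶠ[𝓝 x]
      fun y => ((a ^ 3 - 3 * d y) ^ ((1 : ℝ) / 3)) • gradient d y := by
    filter_upwards [hU.mem_nhds hx] with y hy using hug y hy
  have hfd := (hm.congr_of_eventuallyEq hev).fderiv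
  rw [hfd, hug x hx]
  have hn := heik x hx
  have e1 : (1 : ℝ) / 3 - 1 = -(2 / 3) := by norm_num
  have e2 : (a ^ 3 - 3 * d x) ^ (-((2 : ℝ) / 3)) * (((a ^ 3 - 3 * d x) ^ ((1 : ℝ) / 3)) *
      ((a ^ 3 - 3 * d x) ^ ((1 : ℝ) / 3))) = 1 := by
    rw [← Real.rpow_add hw, ← Real.rpow_add hw]; norm_num
  simp only [ContinuousLinearMap.add_apply, ContinuousLinearMap.smul_apply,
    ContinuousLinearMap.smulRight_apply, ContinuousLinearMap.neg_apply, inner_add_left,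
    inner_smul_left, inner_smul_right, horth, map_smul, InnerProductSpace.toDual_apply_apply,
    real_inner_self_eq_norm_sq, hn, e1, smul_eq_mul, conj_trivial]
  generalize (a ^ 3 - 3 * d x) ^ (-((2 : ℝ) / 3)) = A at *
  generalize (a ^ 3 - 3 * d x) ^ ((1 : ℝ) / 3) = B at *
  linear_combination e2

/-- At maximum points of `d`, the function `u` is differentiable with zero derivative. -/
lemma u_hasFDerivAt_zero {E : Type*} [NormedAddCommGroup E] [InnerProductSpace ℝ E]
    {d u : E → ℝ} {a : ℝ} {z : E}
    (hdL : ∀ x y, |d x - d y| ≤ ‖x - y‖) (hz : d z = a ^ 3 / 3)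
    (hle : ∀ᶠ x in 𝓝 z, d x ≤ a ^ 3 / 3)
    (hu : ∀ x, u x = 1 / 4 * (a ^ 4 - (a ^ 3 - 3 * d x) ^ ((4 : ℝ) / 3))) :
    HasFDerivAt u (0 : E →L[ℝ] ℝ) z := by
  have hb : (fun x => u x - u z) =O[𝓝 z] fun x => ‖x - z‖ ^ ((4 : ℝ) / 3) := by
    apply Asymptotics.IsBigO.of_bound ((1 / 4) * 3 ^ ((4 : ℝ) / 3))
    filter_upwards [hle] with x hx
    have h1 : 0 ≤ a ^ 3 - 3 * d x := by linarith
    have h2 : a ^ 3 - 3 * d x ≤ 3 * ‖x - z‖ := by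
      have := neg_le_of_abs_le (hdL x z); linarith
    have h3 : a ^ 3 - 3 * d z = 0 := by linarith
    have h4 := Real.rpow_le_rpow h1 h2 (by norm_num : (0 : ℝ) ≤ 4 / 3)
    rw [Real.mul_rpow (by norm_num) (norm_nonneg _)] at h4
    have h5 := Real.rpow_nonneg h1 ((4 : ℝ) / 3)
    have h6 := Real.rpow_nonneg (norm_nonneg (x - z)) ((4 : ℝ) / 3)
    rw [hu x, hu z, h3, Real.zero_rpow (by norm_num), Real.norm_eq_abs, Real.norm_eq_abs,
      abs_of_nonneg h6, abs_of_nonpos (by linarith)]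
    linarith
  have ho : (fun x => ‖x - z‖ ^ ((4 : ℝ) / 3)) =o[𝓝 z] fun x => x - z := by
    rw [Asymptotics.isLittleO_iff]
    intro c hc
    have ht : Tendsto (fun x => ‖x - z‖ ^ ((1 : ℝ) / 3)) (𝓝 z) (𝓝 0) := by
      have : ContinuousAt (fun x => ‖x - z‖ ^ ((1 : ℝ) / 3)) z := by
        apply ContinuousAt.rpow_const
        · fun_prop
        · right; norm_num
      have h := this.tendsto
      simpa using h
    filter_upwards [ht.eventually (gt_mem_nhds hc)] with x hx
    have e : (4 : ℝ) / 3 = 1 / 3 + 1 := by norm_num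
    rw [Real.norm_of_nonneg (Real.rpow_nonneg (norm_nonneg _) _), e,
      Real.rpow_add_one' (norm_nonneg _) (by norm_num)]
    exact mul_le_mul_of_nonneg_right hx.le (norm_nonneg _)
  apply HasFDerivAt.of_isLittleO
  simpa using hb.trans_isLittleO ho

lemma quad_bound {E : Type*} [NormedAddCommGroup E] [InnerProductSpace ℝ E]
    {ψ : E → ℝ} {z : E} (hψ : ContDiffAt ℝ 2 ψ z) (h0 : fderiv ℝ ψ z = 0) :
    ∃ K : ℝ, ∃ ε > 0, ∀ x ∈ Metric.ball z ε, |ψ x - ψ z| ≤ K * ‖x - z‖ ^ 2 := by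
  have h1 : DifferentiableAt ℝ (fderiv ℝ ψ) z :=
    (hψ.fderiv_right (m := 1) (by norm_num)).differentiableAt (by norm_num)
  obtain ⟨K, hKp, hK⟩ := h1.hasFDerivAt.isBigO_sub.exists_pos
  have hK := hK.bound
  have hd : ∀ᶠ x in 𝓝 z, DifferentiableAt ℝ ψ x :=
    (hψ.eventually (by simp)).mono fun x hx => hx.differentiableAt (by norm_num)
  obtain ⟨ε, hε, hb⟩ := Metric.eventually_nhds_iff_ball.1 (hK.and hd)
  refine ⟨K, ε, hε, fun x hx => ?_⟩
  have hsub : Metric.closedBall z ‖x - z‖ ⊆ Metric.ball z ε := by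
    apply Metric.closedBall_subset_ball
    rwa [← dist_eq_norm]
  have := (convex_closedBall z ‖x - z‖).norm_image_sub_le_of_norm_fderiv_le (𝕜 := ℝ) (f := ψ)
    (C := K * ‖x - z‖) (fun y hy => (hb y (hsub hy)).2)
    (fun y hy => by
      have h2 := (hb y (hsub hy)).1
      rw [h0, sub_zero] at h2
      rw [mem_closedBall_iff_norm] at hy
      exact h2.trans (mul_le_mul_of_nonneg_left hy hKp.le))
    (Metric.mem_closedBall_self (norm_nonneg _)) (y := x)
    (by rw [mem_closedBall_iff_norm])
  rw [Real.norm_eq_abs] at this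
  linarith [this, sq ‖x - z‖, mul_assoc K ‖x - z‖ ‖x - z‖, congrArg (K * ·) (sq ‖x - z‖)]

lemma no_touch_below {E : Type*} [NormedAddCommGroup E] [InnerProductSpace ℝ E]
    {d u : E → ℝ} {a : ℝ} {z y : E} (ha : 0 < a)
    (hdy : ∀ x, d x ≤ dist x y) (hz : d z = a ^ 3 / 3) (hzy : d z = dist z y)
    (hu0 : HasFDerivAt u (0 : E →L[ℝ] ℝ) z)
    (hu : ∀ x, u x = 1 / 4 * (a ^ 4 - (a ^ 3 - 3 * d x) ^ ((4 : ℝ) / 3)))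
    (ψ : E → ℝ) (hψ : ContDiffAt ℝ 2 ψ z) (hψz : ψ z = u z)
    (hle : ∀ᶠ x in 𝓝 z, ψ x ≤ u x) : False := by
  have hψd : HasFDerivAt ψ (fderiv ℝ ψ z) z :=
    (hψ.differentiableAt (by norm_num)).hasFDerivAt
  have hmax : IsLocalMax (fun x => ψ x - u x) z := by
    filter_upwards [hle] with x hx
    simp only [hψz, sub_self]; linarith
  have h0 : fderiv ℝ ψ z = 0 := by
    have := hmax.hasFDerivAt_eq_zero (hψd.sub hu0)
    simpa using this
  obtain ⟨K, ε, hε, hK⟩ := quad_bound hψ h0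
  set r := dist z y with hr
  have hrp : 0 < r := by rw [← hzy, hz]; positivity
  -- the path towards the nearest boundary point
  let p : ℝ → E := fun s => z + (s ^ 3 / r) • (y - z)
  have hpc : Continuous p := by fun_prop
  have hp0 : p 0 = z := by simp [p]
  have hpt : Tendsto p (𝓝 0) (𝓝 z) := by
    have := hpc.tendsto 0
    rwa [hp0] at this
  have hnyz : ‖y - z‖ = r := by rw [hr, dist_comm, dist_eq_norm]
  have ev1 := hpt.eventually hle
  have ev2 := hpt.eventually (Metric.ball_mem_nhds z hε)
  have ev3 : ∀ᶠ s : ℝ in 𝓝 0, s ^ 3 < r := by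
    have : Tendsto (fun s : ℝ => s ^ 3) (𝓝 0) (𝓝 (0 ^ 3)) := (continuous_pow 3).tendsto 0
    exact this.eventually (gt_mem_nhds (by simpa using hrp))
  have ev4 : ∀ᶠ s : ℝ in 𝓝 0, 4 * K * s ^ 2 < 1 := by
    have hc : Continuous (fun s : ℝ => 4 * K * s ^ 2) := by fun_prop
    exact (hc.tendsto 0).eventually (gt_mem_nhds (by simp))
  have ev := (((ev1.and ev2).and (ev3.and ev4)).filter_mono
    (nhdsWithin_le_nhds (s := Ioi (0 : ℝ)))).and self_mem_nhdsWithin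
  obtain ⟨s, ⟨⟨h1, h2⟩, h3, h4⟩, hs⟩ := ev.exists
  have hs : 0 < s := hs
  have hs3 : 0 < s ^ 3 := by positivity
  have hn : ‖p s - z‖ = s ^ 3 := by
    simp only [p, add_sub_cancel_left, norm_smul, hnyz, Real.norm_eq_abs]
    rw [abs_of_pos (by positivity)]; field_simp
  have hdist : dist (p s) y = r - s ^ 3 := by
    have : p s - y = (s ^ 3 / r - 1) • (y - z) := by
      simp only [p, sub_smul, one_smul]; abel
    rw [dist_eq_norm, this, norm_smul, hnyz, Real.norm_eq_abs, abs_of_neg]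
    · field_simp; ring
    · rw [sub_neg, div_lt_one hrp]; exact h3
  have hds : d (p s) ≤ r - s ^ 3 := hdist ▸ hdy (p s)
  have hw : s ^ 3 ≤ a ^ 3 - 3 * d (p s) := by linarith
  have hpow : s ^ 4 ≤ (a ^ 3 - 3 * d (p s)) ^ ((4 : ℝ) / 3) := by
    have := Real.rpow_le_rpow hs3.le hw (by norm_num : (0 : ℝ) ≤ 4 / 3)
    have e : (s ^ 3) ^ ((4 : ℝ) / 3) = s ^ 4 := by
      rw [← Real.rpow_natCast, ← Real.rpow_mul hs.le, ← Real.rpow_natCast]; norm_num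
    rwa [e] at this
  have huz : u z = 1 / 4 * a ^ 4 := by
    rw [hu z, show a ^ 3 - 3 * d z = 0 by linarith, Real.zero_rpow (by norm_num)]; ring
  have hb := neg_le_of_abs_le (hK _ h2)
  rw [hn] at hb
  rw [hu (p s)] at h1
  have : s ^ 4 ≤ s ^ 4 * (4 * K * s ^ 2) := by nlinarith
  have h5 : 0 < s ^ 4 := by positivity
  nlinarith

/-- sufficiency part of Theorem 2.1: if the distance function `d` to `∂Ω` is `C²`
with `|∇d| = 1` off the ridge-like set `R`, `d = a³/3` on `R` and `d < a³/3` off `R`, then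
`u = (1/4)[a⁴ - (a³ - 3d)^{4/3}]` is a viscosity solution of `-⟨D²u ∇u, ∇u⟩ = 1` in `Ω`:
classical solution on `Ω \ R`; at points of `R`, test functions from above have vanishing
gradient (subsolution condition) and no test function touches from below (supersolution
condition holds vacuously); and `u` extends continuously by `0` to `∂Ω`. -/
theorem stmt_8 (n : ℕ) (Ω : Set (EuclideanSpace ℝ (Fin n))) (hΩo : IsOpen Ω)
    (hΩb : Bornology.IsBounded Ω) (hΩc : IsConnected Ω) (a : ℝ) (ha : 0 < a)
    (d : EuclideanSpace ℝ (Fin n) → ℝ) (hd : ∀ x, d x = Metric.infDist x (frontier Ω))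
    (R : Set (EuclideanSpace ℝ (Fin n))) (hRΩ : R ⊆ Ω) (hRcl : IsOpen (Ω \ R))
    (hdC2 : ContDiffOn ℝ 2 d (Ω \ R))
    (heik : ∀ x ∈ Ω \ R, ‖gradient d x‖ = 1)
    (hdR : ∀ x ∈ R, d x = a ^ 3 / 3)
    (hdlt : ∀ x ∈ Ω \ R, d x < a ^ 3 / 3)
    (u : EuclideanSpace ℝ (Fin n) → ℝ)
    (hu : ∀ x, u x = 1 / 4 * (a ^ 4 - (a ^ 3 - 3 * d x) ^ ((4 : ℝ) / 3))) :
    (∀ x ∈ Ω \ R, -⟪fderiv ℝ (gradient u) x (gradient u x), gradient u x⟫ = 1) ∧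
    (∀ z ∈ R, ∀ φ : EuclideanSpace ℝ (Fin n) → ℝ,
      ContDiffAt ℝ 2 φ z → φ z = u z → (∀ᶠ x in 𝓝 z, u x ≤ φ x) →
      gradient φ z = 0 ∧
        -⟪fderiv ℝ (gradient φ) z (gradient φ z), gradient φ z⟫ ≤ 1) ∧
    (∀ z ∈ R, ¬ ∃ ψ : EuclideanSpace ℝ (Fin n) → ℝ,
      ContDiffAt ℝ 2 ψ z ∧ ψ z = u z ∧ ∀ᶠ x in 𝓝 z, ψ x ≤ u x) ∧
    (∀ y ∈ frontier Ω, Tendsto u (𝓝[Ω] y) (𝓝 0)) := by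
  have hdfun : d = fun x => Metric.infDist x (frontier Ω) := funext hd
  have hdL : ∀ x y, |d x - d y| ≤ ‖x - y‖ := by
    intro x y
    have := (Metric.lipschitz_infDist_pt (frontier Ω)).dist_le_mul x y
    rw [hd, hd]
    simpa [Real.dist_eq, dist_eq_norm] using this
  have hdle : ∀ x ∈ Ω, d x ≤ a ^ 3 / 3 := by
    intro x hx
    by_cases h : x ∈ R
    · exact (hdR x h).le
    · exact (hdlt x ⟨hx, h⟩).le
  have hu0 : ∀ z ∈ R, HasFDerivAt u (0 : EuclideanSpace ℝ (Fin n) →L[ℝ] ℝ) z := by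
    intro z hz
    refine u_hasFDerivAt_zero hdL (hdR z hz) ?_ hu
    filter_upwards [hΩo.mem_nhds (hRΩ hz)] with x hx using hdle x hx
  refine ⟨classical_part hRcl hdC2 heik hdlt hu, ?_, ?_, ?_⟩
  · intro z hz φ hφ hφz hle
    have hφd : HasFDerivAt φ (fderiv ℝ φ z) z :=
      (hφ.differentiableAt (by norm_num)).hasFDerivAt
    have hmin : IsLocalMin (fun x => φ x - u x) z := by
      filter_upwards [hle] with x hx
      simp only [hφz, sub_self]; linarith
    have h0 : fderiv ℝ φ z = 0 := by
      have := hmin.hasFDerivAt_eq_zero (hφd.sub (hu0 z hz))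
      simpa using this
    have hg : gradient φ z = 0 := by simp [gradient, h0]
    refine ⟨hg, ?_⟩
    rw [hg]; simp
  · rintro z hz ⟨ψ, hψ, hψz, hle⟩
    have hne : (frontier Ω).Nonempty := by
      by_contra h
      rw [Set.not_nonempty_iff_eq_empty] at h
      have h1 := hdR z hz
      rw [hd, h, Metric.infDist_empty] at h1
      have : 0 < a ^ 3 := by positivity
      linarith
    obtain ⟨y, hy, hzy⟩ := isClosed_frontier.exists_infDist_eq_dist hne z
    refine no_touch_below ha (fun x => ?_) (hdR z hz) ((hd z).trans hzy) (hu0 z hz) hu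
      ψ hψ hψz hle
    rw [hd]; exact Metric.infDist_le_dist_of_mem hy
  · intro y hy
    have hdy : d y = 0 := by rw [hd]; exact Metric.infDist_zero_of_mem hy
    have huy : u y = 0 := by
      rw [hu, hdy]
      have : (a ^ 3 - 3 * 0) ^ ((4 : ℝ) / 3) = a ^ 4 := by
        rw [mul_zero, sub_zero, ← Real.rpow_natCast, ← Real.rpow_mul ha.le,
          ← Real.rpow_natCast]
        norm_num
      rw [this]; ring
    have hcd : Continuous d := by rw [hdfun]; exact Metric.continuous_infDist_pt _
    have hc : Continuous u := by
      rw [show u = _ from funext hu]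
      refine continuous_const.mul (continuous_const.sub ?_)
      refine Continuous.rpow_const (by fun_prop) fun x => Or.inr (by norm_num)
    have := hc.tendsto y
    rw [huy] at this
    exact this.mono_left nhdsWithin_le_nhds
end

section
/- (Sufficiency part of Theorem 3.1.) Let Ω ⊂ ℝⁿ be a bounded open connected set, a > 0, d(x) = dist(x, ∂Ω), and let R ⊂ Ω be a set closed in Ω such that: d is C² on the open set Ω \ R with |∇d| = 1 there; d(x) = a for every x ∈ R; and d(x) < a for every x ∈ Ω \ R. Define u(x) = d(x)(2a − d(x))/2 for x ∈ Ω. Then u is a viscosity solution of the normalized ∞-Laplace equation −Δ∞ᴺu = 1 in Ω: it satisfies the equation classically on Ω \ R, and at every z ∈ R every C² test function φ touching u from above has ∇φ(z) = 0 and largest Hessian eigenvalue Λ(D²φ(z)) ≥ −1, while every C² test function ψ touching u from below has ∇ψ(z) = 0 and smallest Hessian eigenvalue λ(D²ψ(z)) ≤ −1. Moreover u extends continuously by 0 to ∂Ω. -/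
open Set Filter RealInnerProductSpace Topology

section helpers
variable {n : ℕ}

lemma aux_grad_diff {f : EuclideanSpace ℝ (Fin n) → ℝ} {z : EuclideanSpace ℝ (Fin n)}
    (hf : ContDiffAt ℝ 2 f z) : DifferentiableAt ℝ (gradient f) z := by
  have h1 : ContDiffAt ℝ 1 (fderiv ℝ f) z := hf.fderiv_right (by norm_num)
  have h2 : DifferentiableAt ℝ (fderiv ℝ f) z := h1.differentiableAt (by norm_num)
  exact ((InnerProductSpace.toDual ℝ (EuclideanSpace ℝ (Fin n))).symm.toContinuousLinearEquiv.differentiableAt).comp z h2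

lemma aux_ev_diff {f : EuclideanSpace ℝ (Fin n) → ℝ} {z : EuclideanSpace ℝ (Fin n)}
    (hf : ContDiffAt ℝ 2 f z) : ∀ᶠ x in 𝓝 z, DifferentiableAt ℝ f x := by
  filter_upwards [hf.eventually (by norm_num)] with x hx
  exact hx.differentiableAt (by norm_num)

lemma aux_second {f : EuclideanSpace ℝ (Fin n) → ℝ} {z v : EuclideanSpace ℝ (Fin n)}
    (hf : ContDiffAt ℝ 2 f z) (hg : gradient f z = 0) (c : ℝ)
    (h : ∀ᶠ t in 𝓝[>] (0:ℝ), f (z + t • v) ≤ f z + c * t ^ 2) :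
    ⟪fderiv ℝ (gradient f) z v, v⟫ ≤ 2 * c := by
  by_contra! hlt
  set H : ℝ := ⟪fderiv ℝ (gradient f) z v, v⟫ with hH
  set c' : ℝ := (H / 2 + c) / 2 with hc'
  have hcc : c < c' := by rw [hc']; linarith
  have hHc : 2 * c' < H := by rw [hc']; linarith
  have hline : ∀ t : ℝ, HasDerivAt (fun s : ℝ => z + s • v) v t := by
    intro t
    simpa using ((hasDerivAt_id t).smul_const v).const_add z
  have hcont : Tendsto (fun s : ℝ => z + s • v) (𝓝 0) (𝓝 z) := by
    have := (hline 0).continuousAt.tendsto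
    simpa using this
  let k : ℝ → ℝ := fun t => f (z + t • v) - c' * t ^ 2
  have hk' : ∀ᶠ t in 𝓝 (0:ℝ), HasDerivAt k (⟪gradient f (z + t • v), v⟫ - 2 * c' * t) t := by
    filter_upwards [hcont.eventually (aux_ev_diff hf)] with t ht
    have h1 := (ht.hasGradientAt.hasFDerivAt).comp_hasDerivAt t (hline t)
    have h2 := (hasDerivAt_pow 2 t).const_mul c'
    have h3 := h1.sub h2
    refine HasDerivAt.congr_deriv h3 ?_
    simp [InnerProductSpace.toDual_apply_apply]
    ring
  have hkd : deriv k =ᶠ[𝓝 0] fun t => ⟪gradient f (z + t • v), v⟫ - 2 * c' * t := by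
    filter_upwards [hk'] with t ht using ht.deriv
  have hkdd : HasDerivAt (deriv k) (H - 2 * c') 0 := by
    refine HasDerivAt.congr_of_eventuallyEq ?_ hkd
    have hz : HasFDerivAt (gradient f) (fderiv ℝ (gradient f) z) (z + (0:ℝ) • v) := by
      simpa using (aux_grad_diff hf).hasFDerivAt
    have h1 := (hz.comp_hasDerivAt (0:ℝ) (hline 0)).inner ℝ (hasDerivAt_const (0:ℝ) v)
    have h2 := h1.sub ((hasDerivAt_id (0:ℝ)).const_mul (2 * c'))
    refine HasDerivAt.congr_deriv h2 ?_
    simp [hH]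
  have hmin : IsLocalMin k 0 := by
    refine isLocalMin_of_deriv_deriv_pos ?_ ?_ ?_
    · rw [hkdd.deriv]; linarith
    · rw [hkd.self_of_nhds]; simp [hg]
    · exact hk'.self_of_nhds.continuousAt
  obtain ⟨t, ⟨h1, h2⟩, h3⟩ := ((h.and (hmin.filter_mono nhdsWithin_le_nhds)).and
    self_mem_nhdsWithin).exists
  have ht : (0:ℝ) < t := h3
  simp only [k] at h2
  simp at h2
  nlinarith [pow_pos ht 2]

lemma aux_second' {f : EuclideanSpace ℝ (Fin n) → ℝ} {z v : EuclideanSpace ℝ (Fin n)}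
    (hf : ContDiffAt ℝ 2 f z) (hg : gradient f z = 0) (c : ℝ)
    (h : ∀ᶠ t in 𝓝[>] (0:ℝ), f z + c * t ^ 2 ≤ f (z + t • v)) :
    2 * c ≤ ⟪fderiv ℝ (gradient f) z v, v⟫ := by
  have hgn : gradient (fun x => - f x) = fun x => - gradient f x := by
    funext x
    simp [gradient, fderiv_fun_neg]
  have := aux_second (f := fun x => - f x) (z := z) (v := v) hf.neg (by rw [hgn]; simp [hg]) (-c)
    (by filter_upwards [h] with t ht; linarith)
  rw [hgn, fderiv_fun_neg] at this
  simp only [neg_apply, inner_neg_left] at this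
  linarith

lemma aux_classical {d u : EuclideanSpace ℝ (Fin n) → ℝ} {a : ℝ}
    (hu : ∀ x, u x = d x * (2 * a - d x) / 2) {x : EuclideanSpace ℝ (Fin n)}
    (hd : ContDiffAt ℝ 2 d x) (he : ∀ᶠ y in 𝓝 x, ‖gradient d y‖ = 1) (hlt : d x < a) :
    -⟪fderiv ℝ (gradient u) x (gradient u x), gradient u x⟫ / ‖gradient u x‖ ^ 2 = 1 := by
  have hgu : gradient u =ᶠ[𝓝 x] fun y => (a - d y) • gradient d y := by
    filter_upwards [aux_ev_diff hd] with y hy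
    refine HasGradientAt.gradient ?_
    rw [hasGradientAt_iff_hasFDerivAt]
    have h1 := hy.hasGradientAt.hasFDerivAt
    have h2 := (h1.mul (h1.const_sub (2 * a))).const_mul (1 / 2)
    have hue : u = fun y => 1 / 2 * (d y * (2 * a - d y)) := by
      funext y; rw [hu]; ring
    rw [hue]
    refine HasFDerivAt.congr_fderiv h2 ?_
    ext w
    simp [inner_smul_left, -inner_gradient_left, -inner_gradient_right]
    ring
  have hG := (aux_grad_diff hd).hasFDerivAt
  have hdx := aux_ev_diff hd |>.self_of_nhds.hasGradientAt.hasFDerivAt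
  have h0 : ⟪fderiv ℝ (gradient d) x (gradient d x), gradient d x⟫ = 0 := by
    have h1 := (hG.inner ℝ hG)
    have h2 : HasFDerivAt (fun y => ⟪gradient d y, gradient d y⟫)
        (0 : EuclideanSpace ℝ (Fin n) →L[ℝ] ℝ) x := by
      refine (hasFDerivAt_const (1:ℝ) x).congr_of_eventuallyEq ?_
      filter_upwards [he] with y hy
      rw [real_inner_self_eq_norm_sq, hy]; norm_num
    have h3 := congrArg (fun L => L (gradient d x)) (h1.unique h2)
    simp [-inner_gradient_left, -inner_gradient_right] at h3
    have h4 := real_inner_comm (gradient d x) (fderiv ℝ (gradient d) x (gradient d x))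
    linarith
  have hfd := ((hdx.const_sub a).smul hG).congr_of_eventuallyEq hgu
  have hn : ‖gradient d x‖ = 1 := he.self_of_nhds
  have hpos : 0 < a - d x := by linarith
  rw [hfd.fderiv, hgu.self_of_nhds]
  simp [norm_smul, hn, inner_add_left, inner_smul_left, inner_smul_right, h0,
    real_inner_self_eq_norm_sq, -inner_gradient_left, -inner_gradient_right]
  field_simp
  rw [← inner_gradient_left, real_inner_self_eq_norm_sq, hn]
  norm_num

end helpers

/-- sufficiency part of Theorem 3.1: if the distance function `d` to `∂Ω` is `C²`
with `|∇d| = 1` off the ridge-like set `R`, `d = a` on `R` and `d < a` off `R`, then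
`u = d(2a - d)/2` is a viscosity solution of the normalized ∞-Laplace equation `-Δ∞ᴺu = 1` in
`Ω`: classical solution on `Ω \ R`; at points `z ∈ R`, test functions `φ` from above have
`∇φ(z) = 0` and largest Hessian eigenvalue `≥ -1` (i.e. `⟨D²φ(z)v, v⟩ ≥ -|v|²` for some
`v ≠ 0`), test functions `ψ` from below have `∇ψ(z) = 0` and smallest Hessian eigenvalue `≤ -1`
(i.e. `⟨D²ψ(z)v, v⟩ ≤ -|v|²` for some `v ≠ 0`); and `u` extends continuously by `0` to `∂Ω`. -/
theorem stmt_11 (n : ℕ) (Ω : Set (EuclideanSpace ℝ (Fin n))) (hΩo : IsOpen Ω)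
    (hΩb : Bornology.IsBounded Ω) (hΩc : IsConnected Ω) (a : ℝ) (ha : 0 < a)
    (d : EuclideanSpace ℝ (Fin n) → ℝ) (hd : ∀ x, d x = Metric.infDist x (frontier Ω))
    (R : Set (EuclideanSpace ℝ (Fin n))) (hRΩ : R ⊆ Ω) (hRcl : IsOpen (Ω \ R))
    (hdC2 : ContDiffOn ℝ 2 d (Ω \ R))
    (heik : ∀ x ∈ Ω \ R, ‖gradient d x‖ = 1)
    (hdR : ∀ x ∈ R, d x = a)
    (hdlt : ∀ x ∈ Ω \ R, d x < a)
    (u : EuclideanSpace ℝ (Fin n) → ℝ)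
    (hu : ∀ x, u x = d x * (2 * a - d x) / 2) :
    (∀ x ∈ Ω \ R,
      -⟪fderiv ℝ (gradient u) x (gradient u x), gradient u x⟫ / ‖gradient u x‖ ^ 2 = 1) ∧
    (∀ z ∈ R, ∀ φ : EuclideanSpace ℝ (Fin n) → ℝ,
      ContDiffAt ℝ 2 φ z → φ z = u z → (∀ᶠ x in 𝓝 z, u x ≤ φ x) →
      gradient φ z = 0 ∧
        ∃ v : EuclideanSpace ℝ (Fin n), v ≠ 0 ∧ -‖v‖ ^ 2 ≤ ⟪fderiv ℝ (gradient φ) z v, v⟫) ∧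
    (∀ z ∈ R, ∀ ψ : EuclideanSpace ℝ (Fin n) → ℝ,
      ContDiffAt ℝ 2 ψ z → ψ z = u z → (∀ᶠ x in 𝓝 z, ψ x ≤ u x) →
      gradient ψ z = 0 ∧
        ∃ v : EuclideanSpace ℝ (Fin n), v ≠ 0 ∧ ⟪fderiv ℝ (gradient ψ) z v, v⟫ ≤ -‖v‖ ^ 2) ∧
    (∀ y ∈ frontier Ω, Tendsto u (𝓝[Ω] y) (𝓝 0)) := by
  have hcont : Continuous d := by
    have : d = fun x => Metric.infDist x (frontier Ω) := funext hd
    rw [this]; exact Metric.continuous_infDist_pt _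
  have hle : ∀ x ∈ Ω, d x ≤ a := by
    intro x hx
    by_cases h : x ∈ R
    · exact (hdR x h).le
    · exact (hdlt x ⟨hx, h⟩).le
  have hus : ∀ x, u x = a ^ 2 / 2 - (a - d x) ^ 2 / 2 := by
    intro x; rw [hu]; ring
  have hne : ∀ z ∈ R, (frontier Ω).Nonempty := by
    intro z hz
    by_contra h
    rw [Set.not_nonempty_iff_eq_empty] at h
    have := hdR z hz
    rw [hd, h, Metric.infDist_empty] at this
    linarith
  have hnear : ∀ z ∈ R, ∃ v : EuclideanSpace ℝ (Fin n), ‖v‖ = 1 ∧ z + a • v ∈ frontier Ω := by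
    intro z hz
    obtain ⟨y, hy, hyd⟩ := isClosed_frontier.exists_infDist_eq_dist (hne z hz) z
    rw [← hd, hdR z hz, dist_comm, dist_eq_norm] at hyd
    refine ⟨a⁻¹ • (y - z), ?_, ?_⟩
    · rw [norm_smul, ← hyd, Real.norm_eq_abs, abs_of_pos (inv_pos.2 ha)]
      field_simp
    · rw [smul_smul, mul_inv_cancel₀ ha.ne']
      simpa using hy
  have hline : ∀ z v : EuclideanSpace ℝ (Fin n),
      Tendsto (fun t : ℝ => z + t • v) (𝓝[>] 0) (𝓝 z) := by
    intro z v
    have : Continuous (fun t : ℝ => z + t • v) := by fun_prop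
    have h := this.tendsto 0
    simp only [zero_smul, add_zero] at h
    exact h.mono_left nhdsWithin_le_nhds
  refine ⟨?_, ?_, ?_, ?_⟩
  · intro x hx
    have hN := hRcl.mem_nhds hx
    exact aux_classical hu (hdC2.contDiffAt hN) (by filter_upwards [hN] with y hy using heik y hy)
      (hdlt x hx)
  · intro z hz φ hφ hφz hφu
    have hlow : ∀ᶠ x in 𝓝 z, φ z - ‖x - z‖ ^ 2 / 2 ≤ φ x := by
      filter_upwards [hφu, hΩo.mem_nhds (hRΩ hz)] with x hx hxΩ
      refine le_trans ?_ hx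
      rw [hφz, hus, hus, hdR z hz]
      have h1 : d z ≤ d x + dist z x := by
        rw [hd, hd]; exact Metric.infDist_le_infDist_add_dist
      rw [hdR z hz, dist_comm, dist_eq_norm] at h1
      have h2 := hle x hxΩ
      have : (a - d x) ^ 2 ≤ ‖x - z‖ ^ 2 := pow_le_pow_left₀ (by linarith) (by linarith) 2
      linarith
    have hg : gradient φ z = 0 := by
      have hmin : IsLocalMin (fun x => φ x + ‖x - z‖ ^ 2 / 2) z := by
        filter_upwards [hlow] with x hx
        simp
        linarith
      have hφd := (hφ.differentiableAt (by norm_num)).hasFDerivAt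
      have hsq : HasFDerivAt (fun x => ‖x - z‖ ^ 2 / 2)
          (0 : EuclideanSpace ℝ (Fin n) →L[ℝ] ℝ) z := by
        have h1 := (((hasFDerivAt_id z).sub_const z).norm_sq).mul_const (1 / 2 : ℝ)
        have e : (fun x : EuclideanSpace ℝ (Fin n) => ‖x - z‖ ^ 2 / 2) =
            fun x => ‖id x - z‖ ^ 2 * (1 / 2) := by
          funext x; simp only [id]; ring
        rw [e]
        refine HasFDerivAt.congr_fderiv h1 ?_
        ext w; simp
      have := hmin.hasFDerivAt_eq_zero (hφd.add hsq)
      simp only [add_zero] at this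
      simp [gradient, this]
    refine ⟨hg, ?_⟩
    obtain ⟨v, hv, -⟩ := hnear z hz
    refine ⟨v, fun h => by simp [h] at hv, ?_⟩
    have := aux_second' (v := v) hφ hg (-1 / 2) (by
      filter_upwards [(hline z v).eventually hlow] with t ht
      simp [norm_smul, hv] at ht
      linarith)
    rw [hv]; linarith
  · intro z hz ψ hψ hψz hψu
    have hg : gradient ψ z = 0 := by
      have hmax : IsLocalMax ψ z := by
        filter_upwards [hψu] with x hx
        rw [hψz]
        refine hx.trans ?_
        rw [hus, hus, hdR z hz]
        nlinarith [sq_nonneg (a - d x)]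
      simp [gradient, hmax.fderiv_eq_zero]
    refine ⟨hg, ?_⟩
    obtain ⟨v, hv, hvf⟩ := hnear z hz
    refine ⟨v, fun h => by simp [h] at hv, ?_⟩
    have := aux_second (v := v) hψ hg (-1 / 2) (by
      filter_upwards [(hline z v).eventually hψu, self_mem_nhdsWithin,
        (Iio_mem_nhds ha |> mem_nhdsWithin_of_mem_nhds : Iio a ∈ 𝓝[>] (0:ℝ))] with t ht ht0 hta
      have ht0' : 0 < t := ht0
      have hta' : t < a := hta
      refine ht.trans ?_
      rw [hψz, hus, hus, hdR z hz]
      have h1 : d (z + t • v) ≤ a - t := by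
        rw [hd]
        refine (Metric.infDist_le_dist_of_mem hvf).trans ?_
        rw [dist_eq_norm, add_sub_add_left_eq_sub, ← sub_smul, norm_smul, hv, Real.norm_eq_abs,
          abs_of_neg (by linarith)]
        linarith
      have : t ^ 2 ≤ (a - d (z + t • v)) ^ 2 := pow_le_pow_left₀ ht0'.le (by linarith) 2
      linarith)
    rw [hv]; linarith
  · intro y hy
    have hy0 : d y = 0 := by rw [hd]; exact Metric.infDist_zero_of_mem hy
    have huc : Continuous u := by
      have : u = fun x => d x * (2 * a - d x) / 2 := funext hu
      rw [this]; fun_prop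
    have h := huc.tendsto y
    rw [hu y, hy0] at h
    simp at h
    exact h.mono_left nhdsWithin_le_nhds
end

section
/- (Subsolution half of Theorem 4.1.) Let Ω ⊆ ℝⁿ be open, let p_j → ∞ be a sequence with p_j > 4, and for each j let u_j ∈ C(Ω) be a viscosity subsolution of −|Du|^{p_j−2}( tr(D²u) + (p_j−2)⟨D²u Du, Du⟩/|Du|² ) = 1, meaning: for every x ∈ Ω and every C² function φ such that φ − u_j has a local minimum at x and ∇φ(x) ≠ 0, one has −|∇φ(x)|^{p_j−2}( tr(D²φ(x)) + (p_j−2)⟨D²φ(x)∇φ(x), ∇φ(x)⟩/|∇φ(x)|² ) ≤ 1. Suppose u_j converges locally uniformly on Ω to a function u. Then u is a viscosity subsolution of min{ |Du| − 1, −⟨D²u Du, Du⟩ } = 0 in Ω: for every x₀ ∈ Ω and every C² function φ such that φ − u has a local minimum at x₀, either |∇φ(x₀)| ≤ 1 or −⟨D²φ(x₀)∇φ(x₀), ∇φ(x₀)⟩ ≤ 0. -/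
open Set Filter RealInnerProductSpace Topology

lemma aux_grad_contDiffAt {n : ℕ} {φ : EuclideanSpace ℝ (Fin n) → ℝ}
    {x : EuclideanSpace ℝ (Fin n)} (h : ContDiffAt ℝ 2 φ x) :
    ContDiffAt ℝ 1 (gradient φ) x := by
  have h1 : ContDiffAt ℝ 1 (fderiv ℝ φ) x := h.fderiv_right (by norm_num)
  exact ((InnerProductSpace.toDual ℝ
    (EuclideanSpace ℝ (Fin n))).symm.toContinuousLinearEquiv.contDiff.contDiffAt).comp x h1

lemma aux_hess_cont {n : ℕ} {φ : EuclideanSpace ℝ (Fin n) → ℝ}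
    {x : EuclideanSpace ℝ (Fin n)} (h : ContDiffAt ℝ 2 φ x) :
    ContinuousAt (fderiv ℝ (gradient φ)) x :=
  ((aux_grad_contDiffAt h).fderiv_right (m := 0) (by norm_num)).continuousAt

lemma aux_trace_cont {n : ℕ} :
    Continuous (fun A : EuclideanSpace ℝ (Fin n) →L[ℝ] EuclideanSpace ℝ (Fin n) =>
      LinearMap.trace ℝ (EuclideanSpace ℝ (Fin n)) A.toLinearMap) :=
  ((LinearMap.trace ℝ (EuclideanSpace ℝ (Fin n))).comp
    (ContinuousLinearMap.coeLM ℝ)).continuous_of_finiteDimensional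

lemma aux_quad_contDiff {n : ℕ} (ε : ℝ) (x₀ : EuclideanSpace ℝ (Fin n)) :
    ContDiff ℝ 2 (fun y => ε * ‖y - x₀‖ ^ 2) :=
  contDiff_const.mul ((contDiff_id.sub contDiff_const).norm_sq ℝ)

lemma aux_grad_add {n : ℕ} {φ : EuclideanSpace ℝ (Fin n) → ℝ} (ε : ℝ)
    (x₀ : EuclideanSpace ℝ (Fin n))
    {x : EuclideanSpace ℝ (Fin n)} (h : DifferentiableAt ℝ φ x) :
    gradient (fun y => φ y + ε * ‖y - x₀‖ ^ 2) x = gradient φ x + (2 * ε) • (x - x₀) := by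
  have h1 := h.hasGradientAt.hasFDerivAt
  have h2 : HasFDerivAt (fun y : EuclideanSpace ℝ (Fin n) => ‖y - x₀‖ ^ 2) _ x :=
    ((hasFDerivAt_id x).sub_const x₀).norm_sq
  have h3 := h1.add (h2.const_mul ε)
  refine HasGradientAt.gradient ?_
  rw [hasGradientAt_iff_hasFDerivAt]
  refine HasFDerivAt.congr_fderiv (f := fun y => φ y + ε * ‖y - x₀‖ ^ 2) h3 ?_
  ext v
  simp [inner_add_left, inner_smul_left, inner_sub_left]
  ring

lemma aux_hess_add {n : ℕ} {φ : EuclideanSpace ℝ (Fin n) → ℝ} (ε : ℝ)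
    {x₀ : EuclideanSpace ℝ (Fin n)} (h : ContDiffAt ℝ 2 φ x₀) (v : EuclideanSpace ℝ (Fin n)) :
    fderiv ℝ (gradient (fun y => φ y + ε * ‖y - x₀‖ ^ 2)) x₀ v =
      fderiv ℝ (gradient φ) x₀ v + (2 * ε) • v := by
  have he : gradient (fun y => φ y + ε * ‖y - x₀‖ ^ 2) =ᶠ[𝓝 x₀]
      fun x => gradient φ x + (2 * ε) • (x - x₀) := by
    filter_upwards [h.eventually (by simp)] with x hx
    exact aux_grad_add ε x₀ (hx.differentiableAt (by norm_num))
  rw [he.fderiv_eq]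
  have h1 := ((aux_grad_contDiffAt h).differentiableAt (by norm_num)).hasFDerivAt
  have h2 := ((hasFDerivAt_id (𝕜 := ℝ) x₀).sub_const x₀).const_smul (2 * ε)
  have h3 : HasFDerivAt (fun x => gradient φ x + (2 * ε) • (x - x₀)) _ x₀ := h1.add h2
  rw [h3.fderiv]
  simp

/-- subsolution half of Theorem 4.1: if `u_j` are viscosity subsolutions of the
expanded `p_j`-Laplace equation
`-|Du|^{p_j-2}( tr(D²u) + (p_j-2)⟨D²u Du, Du⟩/|Du|² ) = 1` with `p_j → ∞`, `p_j > 4`, and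
`u_j → u` locally uniformly on `Ω`, then `u` is a viscosity subsolution of
`min{ |Du| - 1, -⟨D²u Du, Du⟩ } = 0`: for every `C²` test function `φ` such that `φ - u` has a
local minimum at `x₀ ∈ Ω`, either `|∇φ(x₀)| ≤ 1` or `-⟨D²φ(x₀)∇φ(x₀), ∇φ(x₀)⟩ ≤ 0`. -/
theorem stmt_17 (n : ℕ) (Ω : Set (EuclideanSpace ℝ (Fin n))) (hΩ : IsOpen Ω)
    (p : ℕ → ℝ) (hp4 : ∀ j, 4 < p j) (hptop : Tendsto p atTop atTop)
    (uj : ℕ → EuclideanSpace ℝ (Fin n) → ℝ) (hujc : ∀ j, ContinuousOn (uj j) Ω)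
    (hsub : ∀ j, ∀ x ∈ Ω, ∀ φ : EuclideanSpace ℝ (Fin n) → ℝ, ContDiffAt ℝ 2 φ x →
      IsLocalMin (fun y => φ y - uj j y) x → gradient φ x ≠ 0 →
      -(‖gradient φ x‖ ^ (p j - 2) *
          (LinearMap.trace ℝ (EuclideanSpace ℝ (Fin n)) (fderiv ℝ (gradient φ) x).toLinearMap +
            (p j - 2) * (⟪fderiv ℝ (gradient φ) x (gradient φ x), gradient φ x⟫ /
              ‖gradient φ x‖ ^ 2))) ≤ 1)
    (u : EuclideanSpace ℝ (Fin n) → ℝ)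
    (hconv : TendstoLocallyUniformlyOn uj u atTop Ω) :
    ∀ x₀ ∈ Ω, ∀ φ : EuclideanSpace ℝ (Fin n) → ℝ, ContDiffAt ℝ 2 φ x₀ →
      IsLocalMin (fun y => φ y - u y) x₀ →
      ‖gradient φ x₀‖ ≤ 1 ∨
        -⟪fderiv ℝ (gradient φ) x₀ (gradient φ x₀), gradient φ x₀⟫ ≤ 0 := by
  intro x₀ hx₀ φ hφ hmin
  by_contra hcon
  push Not at hcon
  obtain ⟨hg, hq⟩ := hcon
  set g := gradient φ x₀ with hgdef
  set q := ⟪fderiv ℝ (gradient φ) x₀ g, g⟫ with hqdef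
  have hgpos : 0 < ‖g‖ ^ 2 := by positivity
  obtain ⟨ε, hε, hεq⟩ : ∃ ε : ℝ, 0 < ε ∧ q + 2 * ε * ‖g‖ ^ 2 < 0 := by
    refine ⟨-q / (4 * ‖g‖ ^ 2), by apply div_pos <;> linarith, ?_⟩
    have : 2 * (-q / (4 * ‖g‖ ^ 2)) * ‖g‖ ^ 2 = -q / 2 := by
      field_simp
      ring
    rw [this]; linarith
  set ψ : EuclideanSpace ℝ (Fin n) → ℝ := fun y => φ y + ε * ‖y - x₀‖ ^ 2 with hψdef
  have hψ : ContDiffAt ℝ 2 ψ x₀ := hφ.add (aux_quad_contDiff ε x₀).contDiffAt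
  have hψg : gradient ψ x₀ = g := by
    rw [hψdef, aux_grad_add ε x₀ (hφ.differentiableAt (by norm_num))]; simp [hgdef]
  have hGc : ContinuousAt (gradient ψ) x₀ := (aux_grad_contDiffAt hψ).continuousAt
  have hHc : ContinuousAt (fderiv ℝ (gradient ψ)) x₀ := aux_hess_cont hψ
  have hTc : ContinuousAt (fun y => LinearMap.trace ℝ (EuclideanSpace ℝ (Fin n))
      (fderiv ℝ (gradient ψ) y).toLinearMap) x₀ :=
    ContinuousAt.comp (f := fderiv ℝ (gradient ψ)) aux_trace_cont.continuousAt hHc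
  have hQc : ContinuousAt (fun y => ⟪fderiv ℝ (gradient ψ) y (gradient ψ y), gradient ψ y⟫ /
      ‖gradient ψ y‖ ^ 2) x₀ := by
    refine ((hHc.clm_apply hGc).inner hGc).div (hGc.norm.pow 2) ?_
    rw [hψg]; exact hgpos.ne'
  have hQ0 : ⟪fderiv ℝ (gradient ψ) x₀ (gradient ψ x₀), gradient ψ x₀⟫ /
      ‖gradient ψ x₀‖ ^ 2 < 0 := by
    rw [hψg]
    refine div_neg_of_neg_of_pos ?_ hgpos
    rw [hψdef, aux_hess_add ε hφ, inner_add_left, inner_smul_left, real_inner_self_eq_norm_sq]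
    simpa using hεq
  obtain ⟨δ, hδ, hQδ⟩ := exists_between hQ0
  obtain ⟨M, hM⟩ := exists_gt (LinearMap.trace ℝ (EuclideanSpace ℝ (Fin n))
      (fderiv ℝ (gradient ψ) x₀).toLinearMap)
  have e1 : ∀ᶠ y in 𝓝 x₀, 1 < ‖gradient ψ y‖ :=
    hGc.norm.eventually (lt_mem_nhds (by show 1 < ‖gradient ψ x₀‖; rw [hψg]; exact hg))
  have e2 := hTc.eventually (gt_mem_nhds hM)
  have e3 := hQc.eventually (gt_mem_nhds hδ)
  have e4 := hψ.eventually (by simp)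
  have e5 := hΩ.mem_nhds hx₀
  have hall := e1.and (e2.and (e3.and (e4.and (hmin.and e5))))
  obtain ⟨r, hr, hball⟩ := Metric.nhds_basis_closedBall.eventually_iff.1 hall
  have hK : IsCompact (Metric.closedBall x₀ r) := isCompact_closedBall x₀ r
  have hKΩ : Metric.closedBall x₀ r ⊆ Ω := fun y hy => (hball hy).2.2.2.2.2
  have hunif := (tendstoLocallyUniformlyOn_iff_forall_isCompact hΩ).1 hconv _ hKΩ hK
  rw [Metric.tendstoUniformlyOn_iff] at hunif
  have hη : 0 < ε * r ^ 2 / 4 := by positivity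
  have hpl := hptop.eventually (eventually_gt_atTop (2 + (1 + M) / (-δ)))
  obtain ⟨j, hj, hpj⟩ := ((hunif _ hη).and hpl).exists
  have hψK : ContinuousOn ψ (Metric.closedBall x₀ r) := fun y hy =>
    (hball hy).2.2.2.1.continuousAt.continuousWithinAt
  have hx₀K : x₀ ∈ Metric.closedBall x₀ r := Metric.mem_closedBall_self hr.le
  obtain ⟨x, hxK, hxmin⟩ := hK.exists_isMinOn ⟨x₀, hx₀K⟩ (hψK.sub ((hujc j).mono hKΩ))
  obtain ⟨b1, b2, b3, b4, b5, b6⟩ := hball hxK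
  have hxr : dist x x₀ < r := by
    refine lt_of_le_of_ne hxK fun heq => ?_
    have h1 : ψ x - uj j x ≤ ψ x₀ - uj j x₀ := hxmin hx₀K
    have h2 := abs_lt.1 (hj x hxK)
    have h3 := abs_lt.1 (hj x₀ hx₀K)
    rw [dist_eq_norm] at heq
    simp only [hψdef, heq, sub_self, norm_zero] at h1
    nlinarith
  have hloc : IsLocalMin (fun y => ψ y - uj j y) x :=
    hxmin.isLocalMin (mem_of_superset (Metric.isOpen_ball.mem_nhds hxr) Metric.ball_subset_closedBall)
  have hfin := hsub j x b6 ψ b4 hloc (by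
    intro h0; rw [h0, norm_zero] at b1; linarith)
  have hp := hp4 j
  have hpow : 1 ≤ ‖gradient ψ x‖ ^ (p j - 2) := Real.one_le_rpow b1.le (by linarith)
  have hM1 : 1 + M < (p j - 2) * (-δ) := by
    rw [← div_lt_iff₀ (by linarith)]; linarith
  have hneg : LinearMap.trace ℝ (EuclideanSpace ℝ (Fin n))
      (fderiv ℝ (gradient ψ) x).toLinearMap +
        (p j - 2) * (⟪fderiv ℝ (gradient ψ) x (gradient ψ x), gradient ψ x⟫ /
          ‖gradient ψ x‖ ^ 2) < -1 := by
    have := mul_lt_mul_of_pos_left b3 (show 0 < p j - 2 by linarith)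
    linarith
  nlinarith
end

section
/- (Supersolution half of Theorem 4.1.) Let Ω ⊆ ℝⁿ be open, let p_j → ∞ be a sequence with p_j > 4, and for each j let u_j ∈ C(Ω) be a viscosity supersolution of −|Du|^{p_j−2}( tr(D²u) + (p_j−2)⟨D²u Du, Du⟩/|Du|² ) = 1, meaning: for every x ∈ Ω and every C² function ψ such that ψ − u_j has a local maximum at x, one has ∇ψ(x) ≠ 0 and −|∇ψ(x)|^{p_j−2}( tr(D²ψ(x)) + (p_j−2)⟨D²ψ(x)∇ψ(x), ∇ψ(x)⟩/|∇ψ(x)|² ) ≥ 1. Suppose u_j converges locally uniformly on Ω to a function u. Then u is a viscosity supersolution of min{ |Du| − 1, −⟨D²u Du, Du⟩ } = 0 in Ω: for every x₀ ∈ Ω and every C² function ψ such that ψ − u has a local maximum at x₀, one has |∇ψ(x₀)| ≥ 1 and −⟨D²ψ(x₀)∇ψ(x₀), ∇ψ(x₀)⟩ ≥ 0. In particular u satisfies |Du| ≥ 1 in the viscosity sense. -/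
open Set Filter RealInnerProductSpace Topology

section Helpers

variable {n : ℕ}


lemma quartic_grad (x₀ y : (EuclideanSpace ℝ (Fin n))) :
    HasGradientAt (fun y : (EuclideanSpace ℝ (Fin n)) => (‖y - x₀‖ ^ 2) ^ 2) ((4 * ‖y - x₀‖ ^ 2) • (y - x₀)) y := by
  rw [hasGradientAt_iff_hasFDerivAt]
  have h1 : HasFDerivAt (fun y : (EuclideanSpace ℝ (Fin n)) => y - x₀) (ContinuousLinearMap.id ℝ (EuclideanSpace ℝ (Fin n))) y :=
    (hasFDerivAt_id y).sub_const x₀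
  have h2 := (h1.norm_sq).pow 2
  refine h2.congr_fderiv ?_
  ext v
  simp
  ring

lemma quartic_hess (x₀ : (EuclideanSpace ℝ (Fin n))) :
    HasFDerivAt (fun y : (EuclideanSpace ℝ (Fin n)) => (4 * ‖y - x₀‖ ^ 2) • (y - x₀)) (0 : (EuclideanSpace ℝ (Fin n)) →L[ℝ] (EuclideanSpace ℝ (Fin n))) x₀ := by
  have h1 : HasFDerivAt (fun y : (EuclideanSpace ℝ (Fin n)) => y - x₀) (ContinuousLinearMap.id ℝ (EuclideanSpace ℝ (Fin n))) x₀ :=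
    (hasFDerivAt_id x₀).sub_const x₀
  have h2 := (h1.norm_sq).const_mul 4
  refine (h2.smul h1).congr_fderiv ?_
  ext v
  simp

lemma grad_contDiffAt {ψ : (EuclideanSpace ℝ (Fin n)) → ℝ} {x : (EuclideanSpace ℝ (Fin n))} (h : ContDiffAt ℝ 2 ψ x) :
    ContDiffAt ℝ 1 (gradient ψ) x := by
  have h1 : ContDiffAt ℝ 1 (fderiv ℝ ψ) x := h.fderiv_right (by norm_num)
  exact (InnerProductSpace.toDual ℝ (EuclideanSpace ℝ (Fin n))).symm.contDiff.contDiffAt.comp x h1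

lemma perturb {ψ : (EuclideanSpace ℝ (Fin n)) → ℝ} {x₀ : (EuclideanSpace ℝ (Fin n))} (h : ContDiffAt ℝ 2 ψ x₀) :
    ContDiffAt ℝ 2 (fun y => ψ y - (‖y - x₀‖ ^ 2) ^ 2) x₀ ∧
    gradient (fun y => ψ y - (‖y - x₀‖ ^ 2) ^ 2) x₀ = gradient ψ x₀ ∧
    fderiv ℝ (gradient (fun y => ψ y - (‖y - x₀‖ ^ 2) ^ 2)) x₀ = fderiv ℝ (gradient ψ) x₀ := by
  have hev : ∀ᶠ y in 𝓝 x₀, ContDiffAt ℝ 2 ψ y := h.eventually (by norm_num)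
  have key : gradient (fun y => ψ y - (‖y - x₀‖ ^ 2) ^ 2) =ᶠ[𝓝 x₀]
      fun y => gradient ψ y - (4 * ‖y - x₀‖ ^ 2) • (y - x₀) := by
    filter_upwards [hev] with y hy
    have h1 : HasGradientAt ψ (gradient ψ y) y :=
      (hy.differentiableAt (by norm_num)).hasGradientAt
    have h2 := quartic_grad x₀ y
    rw [hasGradientAt_iff_hasFDerivAt] at h1 h2
    have h3 := h1.sub h2
    rw [← map_sub] at h3
    exact (hasGradientAt_iff_hasFDerivAt.mpr h3).gradient
  refine ⟨h.sub ?_, ?_, ?_⟩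
  · exact (((contDiff_id.sub contDiff_const).norm_sq ℝ).pow 2).contDiffAt
  · rw [key.eq_of_nhds]; simp
  · rw [key.fderiv_eq]
    have h1 := ((grad_contDiffAt h).differentiableAt (by norm_num)).hasFDerivAt
    have h2 := h1.sub (quartic_hess x₀)
    rw [sub_zero] at h2
    exact h2.fderiv

lemma touching {Ω : Set (EuclideanSpace ℝ (Fin n))} (hΩ : IsOpen Ω) {uj : ℕ → (EuclideanSpace ℝ (Fin n)) → ℝ}
    (hujc : ∀ j, ContinuousOn (uj j) Ω) {u : (EuclideanSpace ℝ (Fin n)) → ℝ}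
    (hconv : TendstoLocallyUniformlyOn uj u atTop Ω) {x₀ : (EuclideanSpace ℝ (Fin n))} (hx₀ : x₀ ∈ Ω) {ψ : (EuclideanSpace ℝ (Fin n)) → ℝ}
    (hψ : ContDiffAt ℝ 2 ψ x₀) (hmax : IsLocalMax (fun y => ψ y - u y) x₀)
    {P : (EuclideanSpace ℝ (Fin n)) → Prop} (hP : ∀ᶠ y in 𝓝 x₀, P y) :
    ∀ᶠ j in atTop, ∃ x ∈ Ω, P x ∧
      IsLocalMax (fun y => (ψ y - (‖y - x₀‖ ^ 2) ^ 2) - uj j y) x := by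
  have hev : ∀ᶠ y in 𝓝 x₀, ContDiffAt ℝ 2 ψ y := hψ.eventually (by norm_num)
  obtain ⟨r, hr, hsub⟩ := Metric.nhds_basis_closedBall.eventually_iff.mp
    (hP.and (hev.and (hmax.and (hΩ.mem_nhds hx₀))))
  have hcomp : IsCompact (Metric.closedBall x₀ r) := isCompact_closedBall x₀ r
  have hunif := (tendstoLocallyUniformlyOn_iff_forall_isCompact hΩ).mp hconv _
    (fun y hy => (hsub hy).2.2.2) hcomp
  have hε : 0 < (r ^ 2) ^ 2 / 4 := by positivity
  filter_upwards [Metric.tendstoUniformlyOn_iff.mp hunif _ hε] with j hj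
  have hx0mem : x₀ ∈ Metric.closedBall x₀ r := Metric.mem_closedBall_self hr.le
  have hcont : ContinuousOn (fun y => (ψ y - (‖y - x₀‖ ^ 2) ^ 2) - uj j y)
      (Metric.closedBall x₀ r) := by
    refine ContinuousOn.sub (ContinuousOn.sub ?_ ?_) ?_
    · exact fun y hy => (hsub hy).2.1.continuousAt.continuousWithinAt
    · fun_prop
    · exact (hujc j).mono (fun y hy => (hsub hy).2.2.2)
  obtain ⟨x, hx, hxm⟩ := hcomp.exists_isMaxOn ⟨x₀, hx0mem⟩ hcont
  have hlt : dist x x₀ < r := by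
    refine lt_of_le_of_ne hx ?_
    intro heq
    have h1 := hxm hx0mem
    have h2 := (hsub hx).2.2.1
    have h3 := hj x hx
    have h4 := hj x₀ hx0mem
    rw [Real.dist_eq, abs_lt] at h3 h4
    rw [dist_eq_norm] at heq
    simp only [mem_ofPred_eq, heq, sub_self, norm_zero] at h1 h2
    norm_num at h1
    linarith [h3.1, h3.2, h4.1, h4.2]
  exact ⟨x, (hsub hx).2.2.2, (hsub hx).1, hxm.isLocalMax
    (mem_of_superset (Metric.isOpen_ball.mem_nhds hlt) Metric.ball_subset_closedBall)⟩

lemma decay {θ C : ℝ} (h0 : 0 < θ) (h1 : θ < 1) {p : ℕ → ℝ} (hptop : Tendsto p atTop atTop) :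
    ∀ᶠ j in atTop, θ ^ (p j - 2) * (C + (p j - 2) * C) < 1 := by
  have hq : Tendsto (fun j => p j - 2) atTop atTop := tendsto_atTop_add_const_right _ _ hptop
  have hb : 0 < -Real.log θ := by linarith [Real.log_neg h0 h1]
  have e1 : Tendsto (fun s : ℝ => s ^ (1 : ℝ) * Real.exp (-(-Real.log θ) * s)) atTop (𝓝 0) :=
    tendsto_rpow_mul_exp_neg_mul_atTop_nhds_zero 1 _ hb
  have e0 : Tendsto (fun s : ℝ => s ^ (0 : ℝ) * Real.exp (-(-Real.log θ) * s)) atTop (𝓝 0) :=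
    tendsto_rpow_mul_exp_neg_mul_atTop_nhds_zero 0 _ hb
  have e := ((e0.const_mul C).add (e1.const_mul C)).comp hq
  simp only [mul_zero, add_zero] at e
  filter_upwards [e.eventually_lt_const one_pos] with j hj
  have : θ ^ (p j - 2) = Real.exp (Real.log θ * (p j - 2)) := Real.rpow_def_of_pos h0 _
  rw [this]
  simp only [Function.comp, Real.rpow_zero, Real.rpow_one, neg_neg] at hj
  linarith

lemma inner_quot (H : (EuclideanSpace ℝ (Fin n)) →L[ℝ] (EuclideanSpace ℝ (Fin n))) (v : (EuclideanSpace ℝ (Fin n))) : |⟪H v, v⟫ / ‖v‖ ^ 2| ≤ ‖H‖ := by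
  rw [abs_div, abs_of_nonneg (sq_nonneg ‖v‖)]
  refine div_le_of_le_mul₀ (sq_nonneg _) (norm_nonneg _) ?_
  calc |⟪H v, v⟫| ≤ ‖H v‖ * ‖v‖ := abs_real_inner_le_norm _ _
    _ ≤ (‖H‖ * ‖v‖) * ‖v‖ := by gcongr; exact H.le_opNorm v
    _ = _ := by ring

lemma trace_cont : Continuous (fun H : (EuclideanSpace ℝ (Fin n)) →L[ℝ] (EuclideanSpace ℝ (Fin n)) => LinearMap.trace ℝ (EuclideanSpace ℝ (Fin n)) H.toLinearMap) :=
  ((LinearMap.trace ℝ (EuclideanSpace ℝ (Fin n))).comp (ContinuousLinearMap.coeLM ℝ)).continuous_of_finiteDimensional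

end Helpers

/-- supersolution half of Theorem 4.1: if `u_j` are viscosity supersolutions of
the expanded `p_j`-Laplace equation
`-|Du|^{p_j-2}( tr(D²u) + (p_j-2)⟨D²u Du, Du⟩/|Du|² ) = 1` with `p_j → ∞`, `p_j > 4` (where no
touching test function can have vanishing gradient), and `u_j → u` locally uniformly on `Ω`,
then `u` is a viscosity supersolution of `min{ |Du| - 1, -⟨D²u Du, Du⟩ } = 0`: for every `C²`
test function `ψ` such that `ψ - u` has a local maximum at `x₀ ∈ Ω`, one has `|∇ψ(x₀)| ≥ 1` and
`-⟨D²ψ(x₀)∇ψ(x₀), ∇ψ(x₀)⟩ ≥ 0`. In particular `u` satisfies `|Du| ≥ 1` in the viscosity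
sense. -/
theorem stmt_18 (n : ℕ) (Ω : Set (EuclideanSpace ℝ (Fin n))) (hΩ : IsOpen Ω)
    (p : ℕ → ℝ) (hp4 : ∀ j, 4 < p j) (hptop : Tendsto p atTop atTop)
    (uj : ℕ → EuclideanSpace ℝ (Fin n) → ℝ) (hujc : ∀ j, ContinuousOn (uj j) Ω)
    (hsuper : ∀ j, ∀ x ∈ Ω, ∀ ψ : EuclideanSpace ℝ (Fin n) → ℝ, ContDiffAt ℝ 2 ψ x →
      IsLocalMax (fun y => ψ y - uj j y) x →
      gradient ψ x ≠ 0 ∧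
        1 ≤ -(‖gradient ψ x‖ ^ (p j - 2) *
          (LinearMap.trace ℝ (EuclideanSpace ℝ (Fin n)) (fderiv ℝ (gradient ψ) x).toLinearMap +
            (p j - 2) * (⟪fderiv ℝ (gradient ψ) x (gradient ψ x), gradient ψ x⟫ /
              ‖gradient ψ x‖ ^ 2))))
    (u : EuclideanSpace ℝ (Fin n) → ℝ)
    (hconv : TendstoLocallyUniformlyOn uj u atTop Ω) :
    ∀ x₀ ∈ Ω, ∀ ψ : EuclideanSpace ℝ (Fin n) → ℝ, ContDiffAt ℝ 2 ψ x₀ →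
      IsLocalMax (fun y => ψ y - u y) x₀ →
      1 ≤ ‖gradient ψ x₀‖ ∧
        0 ≤ -⟪fderiv ℝ (gradient ψ) x₀ (gradient ψ x₀), gradient ψ x₀⟫ := by
  intro x₀ hx₀ ψ hψ hmax
  obtain ⟨φ, hφ, hg, hH, htouch⟩ : ∃ φ : EuclideanSpace ℝ (Fin n) → ℝ, ContDiffAt ℝ 2 φ x₀ ∧
      gradient φ x₀ = gradient ψ x₀ ∧
      fderiv ℝ (gradient φ) x₀ = fderiv ℝ (gradient ψ) x₀ ∧
      ∀ P : EuclideanSpace ℝ (Fin n) → Prop, (∀ᶠ y in 𝓝 x₀, P y) →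
        ∀ᶠ j in atTop, ∃ x ∈ Ω, P x ∧ IsLocalMax (fun y => φ y - uj j y) x := by
    obtain ⟨hφ, hg, hH⟩ := perturb hψ
    exact ⟨_, hφ, hg, hH, fun P hP => touching hΩ hujc hconv hx₀ hψ hmax hP⟩
  rw [← hg, ← hH]
  have hφev : ∀ᶠ y in 𝓝 x₀, ContDiffAt ℝ 2 φ y := hφ.eventually (by norm_num)
  have hgc : ContinuousAt (gradient φ) x₀ := (grad_contDiffAt hφ).continuousAt
  have hHc : ContinuousAt (fderiv ℝ (gradient φ)) x₀ :=
    ((grad_contDiffAt hφ).fderiv_right (m := 0) (by norm_num)).continuousAt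
  have hTc : ContinuousAt (fun y => LinearMap.trace ℝ (EuclideanSpace ℝ (Fin n))
      (fderiv ℝ (gradient φ) y).toLinearMap) x₀ := trace_cont.continuousAt.comp hHc
  have hQc : ContinuousAt
      (fun y => ⟪fderiv ℝ (gradient φ) y (gradient φ y), gradient φ y⟫) x₀ :=
    ContinuousAt.inner (hHc.clm_apply hgc) hgc
  obtain ⟨C, hC1, hC2⟩ : ∃ C : ℝ,
      |LinearMap.trace ℝ (EuclideanSpace ℝ (Fin n)) (fderiv ℝ (gradient φ) x₀).toLinearMap| < C ∧
      ‖fderiv ℝ (gradient φ) x₀‖ < C :=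
    ⟨max _ _ + 1, lt_of_le_of_lt (le_max_left _ _) (lt_add_one _),
      lt_of_le_of_lt (le_max_right _ _) (lt_add_one _)⟩
  have eT := hTc.abs.eventually_lt_const hC1
  have eH := hHc.norm.eventually_lt_const hC2
  constructor
  · by_contra! hlt
    obtain ⟨θ, hθ1, hθ2⟩ := exists_between hlt
    have hθ0 : 0 < θ := lt_of_le_of_lt (norm_nonneg _) hθ1
    have eg := hgc.norm.eventually_lt_const hθ1
    obtain ⟨j, ⟨x, hxΩ, ⟨hx1, hx2, hx3, hx4⟩, hxm⟩, hd⟩ :=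
      ((htouch _ (hφev.and (eT.and (eH.and eg)))).and (decay (C := C) hθ0 hθ2 hptop)).exists
    obtain ⟨-, hs⟩ := hsuper j x hxΩ φ hx1 hxm
    have hp := hp4 j
    have hq := (inner_quot (fderiv ℝ (gradient φ) x) (gradient φ x)).trans hx3.le
    have hpow : ‖gradient φ x‖ ^ (p j - 2) ≤ θ ^ (p j - 2) :=
      Real.rpow_le_rpow (norm_nonneg _) hx4.le (by linarith)
    have hpow0 : 0 ≤ ‖gradient φ x‖ ^ (p j - 2) := Real.rpow_nonneg (norm_nonneg _) _
    have hC0 : 0 ≤ C := (norm_nonneg _).trans hx3.le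
    generalize ⟪fderiv ℝ (gradient φ) x (gradient φ x), gradient φ x⟫ / ‖gradient φ x‖ ^ 2 = q at *
    generalize LinearMap.trace ℝ (EuclideanSpace ℝ (Fin n))
      (fderiv ℝ (gradient φ) x).toLinearMap = T at *
    generalize ‖gradient φ x‖ ^ (p j - 2) = a at *
    have hb : -(T + (p j - 2) * q) ≤ C + (p j - 2) * C := by
      have := mul_le_mul_of_nonneg_left (abs_le.mp hq).1 (by linarith : 0 ≤ p j - 2)
      have := (abs_lt.mp hx2).1
      linarith
    have h1 : a * -(T + (p j - 2) * q) ≤ a * (C + (p j - 2) * C) :=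
      mul_le_mul_of_nonneg_left hb hpow0
    have h2 : a * (C + (p j - 2) * C) ≤ θ ^ (p j - 2) * (C + (p j - 2) * C) :=
      mul_le_mul_of_nonneg_right hpow
        (add_nonneg hC0 (mul_nonneg (by linarith) hC0))
    linarith
  · by_contra! hlt
    have hQ0 : 0 < ⟪fderiv ℝ (gradient φ) x₀ (gradient φ x₀), gradient φ x₀⟫ := by linarith
    obtain ⟨c, hc0, hc⟩ := exists_between hQ0
    have eQ := hQc.eventually_const_lt hc
    obtain ⟨M, hM⟩ := exists_gt (‖gradient φ x₀‖ ^ 2)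
    have eM := (hgc.norm.pow 2).eventually_lt_const hM
    have hM0 : 0 < M := lt_of_le_of_lt (sq_nonneg _) hM
    have hlarge : ∀ᶠ j in atTop, C * M / c + 2 < p j := hptop.eventually_gt_atTop _
    obtain ⟨j, ⟨x, hxΩ, ⟨hx1, hx2, hx3, hx4⟩, hxm⟩, hd⟩ :=
      ((htouch _ (hφev.and (eT.and (eQ.and eM)))).and hlarge).exists
    obtain ⟨hne, hs⟩ := hsuper j x hxΩ φ hx1 hxm
    have hp := hp4 j
    have hn : 0 < ‖gradient φ x‖ ^ 2 := by positivity
    have hq : c / M ≤ ⟪fderiv ℝ (gradient φ) x (gradient φ x), gradient φ x⟫ /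
        ‖gradient φ x‖ ^ 2 := div_le_div₀ (hc0.trans hx3).le hx3.le hn hx4.le
    have hpow0 : 0 ≤ ‖gradient φ x‖ ^ (p j - 2) := Real.rpow_nonneg (norm_nonneg _) _
    have h1 := mul_le_mul_of_nonneg_left hq (by linarith : 0 ≤ p j - 2)
    have h2 : C < (p j - 2) * (c / M) := by
      rw [← mul_div_assoc, lt_div_iff₀ hM0, ← div_lt_iff₀ hc0]
      linarith
    have h3 := (abs_lt.mp hx2).1
    have h4 := mul_nonneg hpow0 (by linarith : 0 ≤ LinearMap.trace ℝ (EuclideanSpace ℝ (Fin n))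
      (fderiv ℝ (gradient φ) x).toLinearMap + (p j - 2) *
        (⟪fderiv ℝ (gradient φ) x (gradient φ x), gradient φ x⟫ / ‖gradient φ x‖ ^ 2))
    linarith
end
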